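/- Suppose condition (B_p) holds for some p > 2, and conditions (Q_∞) and (M_L) hold. Then there exists ε > 0 such that sup_x E[|Y_{n+1} − Y_n|^{2+ε} | Y_n = x] < ∞; and, as x → ∞, E[Y_{n+1} − Y_n | Y_n = x] = (1/π(0)) Σ_{i∈S} c_i π(i)/x + o(x^{−1}) and E[(Y_{n+1} − Y_n)² | Y_n = x] = (1/π(0)) Σ_{i∈S} s_i² π(i) + o(1). If, in addition, conditions (Q_∞^+) and (M_L^+) hold, then there exists δ > 0 such that E[Y_{n+1} − Y_n | Y_n = x] = (1/π(0)) Σ_{i∈S} c_i π(i)/x + O(x^{−1−δ}) and E[(Y_{n+1} − Y_n)² | Y_n = x] = (1/π(0)) Σ_{i∈S} s_i² π(i) + O(x^{−δ}). -/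

import Mathlib

open MeasureTheory Filter Topology Asymptotics
open scoped ENNReal NNReal

/-- A time-homogeneous Markov chain on a measurable state space `E`, encoded via the family
`P z` of laws (on trajectory space) of the chain started at `z`.  The field `markov` is the
time-homogeneous Markov property: conditionally on the event `{ω n = w}` intersected with any
event `B` depending only on the first `n+1` coordinates, the shifted trajectory has law `P w`. -/
structure MChain (E : Type*) [MeasurableSpace E] where
  P : E → MeasureTheory.Measure (ℕ → E)
  isProb : ∀ z, MeasureTheory.IsProbabilityMeasure (P z)
  init : ∀ z, P z {ω | ω 0 = z} = 1
  markov : ∀ (z : E) (n : ℕ) (w : E) (A B : Set (ℕ → E)), MeasurableSet A →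
    (∀ ω ω' : ℕ → E, (∀ k, k ≤ n → ω k = ω' k) → ω ∈ B → ω' ∈ B) →
    P z (B ∩ {ω | ω n = w} ∩ {ω | (fun k => ω (n + k)) ∈ A})
      = P z (B ∩ {ω | ω n = w}) * P w A

namespace MChain

variable {E : Type*} [MeasurableSpace E]

/-- Irreducibility: every state can be reached from every state with positive probability. -/
def Irreducible (X : MChain E) : Prop := ∀ z w : E, ∃ n : ℕ, X.P z {ω | ω n = w} ≠ 0

/-- Recurrence: from every state, the chain returns to it almost surely. -/
def Recurrent (X : MChain E) : Prop := ∀ z : E, X.P z {ω | ∃ n, 1 ≤ n ∧ ω n = z} = 1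

def Transient (X : MChain E) : Prop := ¬ X.Recurrent

/-- The first return time to `z` (with junk value `0`, via `sInf ∅ = 0`, if there is no return). -/
noncomputable def returnTime (z : E) (ω : ℕ → E) : ℕ := sInf {n | 1 ≤ n ∧ ω n = z}

/-- Positive recurrence: recurrent, with finite mean return times. -/
def PositiveRecurrent (X : MChain E) : Prop :=
  X.Recurrent ∧ ∀ z : E, (∫⁻ ω, (returnTime z ω : ℝ≥0∞) ∂(X.P z)) ≠ ⊤

def NullRecurrent (X : MChain E) : Prop := X.Recurrent ∧ ¬ X.PositiveRecurrent

end MChain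

section HalfStrip

variable {S : Type*} [Fintype S] [DecidableEq S] [Nonempty S]
  [MeasurableSpace S] [MeasurableSingletonClass S]

/-- `qhat X x i j` is the probability that the `S`-coordinate moves from `i` to `j` when the
`ℕ`-coordinate is at `x`; this is `q_x(i,j) = Σ_y p(x,i,y,j)` of the paper. -/
noncomputable def qhat (X : MChain (ℕ × S)) (x : ℕ) (i j : S) : ℝ :=
  (X.P (x, i) {ω | (ω 1).2 = j}).toReal

/-- `stepMoment X k x i = μ_k(x,i) = E[(X_{n+1}-X_n)^k | X_n = x, η_n = i]`. -/
noncomputable def stepMoment (X : MChain (ℕ × S)) (k : ℕ) (x : ℕ) (i : S) : ℝ :=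
  ∫ ω, (((ω 1).1 : ℝ) - (x : ℝ)) ^ k ∂(X.P (x, i))

/-- Condition (B_p): uniformly bounded conditional `p`-th moments of the jumps of the
`ℕ`-coordinate (by the Markov property, the conditional moment given `F_n` is a function of
the current state only). -/
def CondB (X : MChain (ℕ × S)) (p : ℝ) : Prop :=
  ∃ C : ℝ≥0∞, C ≠ ⊤ ∧ ∀ (x : ℕ) (i : S),
    (∫⁻ ω, ENNReal.ofReal (|((ω 1).1 : ℝ) - (x : ℝ)| ^ p) ∂(X.P (x, i))) ≤ C

def IsStochasticMatrix (Q : S → S → ℝ) : Prop :=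
  (∀ i j, 0 ≤ Q i j) ∧ ∀ i, (∑ j, Q i j) = 1

def IsIrreducibleMatrix (Q : S → S → ℝ) : Prop :=
  ∀ i j, ∃ n : ℕ, 0 < ((Matrix.of Q) ^ n) i j

/-- Aperiodicity (for a finite irreducible stochastic matrix, eventual positivity of the
diagonal entries of the powers is equivalent to aperiodicity). -/
def IsAperiodicMatrix (Q : S → S → ℝ) : Prop :=
  ∀ i, ∃ N : ℕ, ∀ n, N ≤ n → 0 < ((Matrix.of Q) ^ n) i i

/-- `pst` is a (strictly positive) stationary distribution for `Q`. -/
def IsStationaryDist (Q : S → S → ℝ) (pst : S → ℝ) : Prop :=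
  (∀ i, 0 < pst i) ∧ (∑ i, pst i) = 1 ∧ ∀ j, (∑ i, pst i * Q i j) = pst j

/-- Condition (Q_∞): the transition matrix of the `S`-coordinate converges as `x → ∞` to an
irreducible stochastic matrix `Q`. -/
def CondQ (X : MChain (ℕ × S)) (Q : S → S → ℝ) : Prop :=
  (∀ i j, Tendsto (fun x : ℕ => qhat X x i j) atTop (nhds (Q i j))) ∧
    IsStochasticMatrix Q ∧ IsIrreducibleMatrix Q

/-- Condition (Q_∞^+): as (Q_∞), with a power-law rate of convergence. -/
def CondQplus (X : MChain (ℕ × S)) (Q : S → S → ℝ) : Prop :=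
  (∃ δ₀ : ℝ, 0 < δ₀ ∧ ∀ i j,
      (fun x : ℕ => qhat X x i j - Q i j) =O[atTop] fun x : ℕ => (x : ℝ) ^ (-δ₀)) ∧
    IsStochasticMatrix Q ∧ IsIrreducibleMatrix Q

/-- Condition (M_C): asymptotically constant drifts, `μ₁(x,i) = d_i + o(1)`. -/
def CondMC (X : MChain (ℕ × S)) (d : S → ℝ) : Prop :=
  ∀ i, Tendsto (fun x : ℕ => stepMoment X 1 x i) atTop (nhds (d i))

/-- Condition (M_L): Lamperti-type drifts, `μ₁(x,i) = c_i/x + o(1/x)`, `μ₂(x,i) = s_i² + o(1)`,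
with at least one `s_i²` nonzero. -/
def CondML (X : MChain (ℕ × S)) (c s2 : S → ℝ) : Prop :=
  (∀ i, 0 ≤ s2 i) ∧ (∃ i, s2 i ≠ 0) ∧
    (∀ i, Tendsto (fun x : ℕ => (x : ℝ) * stepMoment X 1 x i) atTop (nhds (c i))) ∧
    (∀ i, Tendsto (fun x : ℕ => stepMoment X 2 x i) atTop (nhds (s2 i)))

/-- Condition (M_L^+): Lamperti-type drifts with power-law error bounds. -/
def CondMLplus (X : MChain (ℕ × S)) (c s2 : S → ℝ) : Prop :=
  (∀ i, 0 ≤ s2 i) ∧ (∃ i, s2 i ≠ 0) ∧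
    ∃ δ₁ : ℝ, 0 < δ₁ ∧ ∀ i,
      ((fun x : ℕ => stepMoment X 1 x i - c i / (x : ℝ)) =O[atTop]
        fun x : ℕ => (x : ℝ) ^ (-1 - δ₁)) ∧
      ((fun x : ℕ => stepMoment X 2 x i - s2 i) =O[atTop] fun x : ℕ => (x : ℝ) ^ (-δ₁))

/-- Successive visit times `τ_0 < τ_1 < ⋯` of the `S`-coordinate to the distinguished state
`s0` (junk value, via `sInf ∅ = 0`, if there is no such visit). -/
noncomputable def tauSeq (s0 : S) (ω : ℕ → ℕ × S) : ℕ → ℕ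
  | 0 => sInf {n | (ω n).2 = s0}
  | m + 1 => sInf {n | tauSeq s0 ω m < n ∧ (ω n).2 = s0}

/-- `τ`, the first positive time at which the `S`-coordinate visits `s0`. -/
noncomputable def tauRet (s0 : S) (ω : ℕ → ℕ × S) : ℕ :=
  sInf {n | 1 ≤ n ∧ (ω n).2 = s0}

/-- `D_n`, the maximal displacement of the `ℕ`-coordinate during the `n`-th excursion. -/
noncomputable def Dexc (s0 : S) (n : ℕ) (ω : ℕ → ℕ × S) : ℕ :=
  Finset.sup (Finset.Icc (tauSeq s0 ω n) (tauSeq s0 ω (n + 1)))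
    fun m => Nat.dist (ω m).1 (ω (tauSeq s0 ω n)).1

/-- `N(n) = max {k : τ_k ≤ n}`. -/
noncomputable def Ncount (s0 : S) (n : ℕ) (ω : ℕ → ℕ × S) : ℕ :=
  sSup {k | tauSeq s0 ω k ≤ n}

end HalfStrip

/-- `Fdist a t` is the distribution function of the square root of a `Gamma(a,t)` random
variable: `F_{a,t}(x) = ∫_0^x 2 u^{2a-1} e^{-u²/t} / (t^a Γ(a)) du`. -/
noncomputable def Fdist (a t x : ℝ) : ℝ :=
  ∫ u in (0:ℝ)..x, 2 * u ^ (2 * a - 1) * Real.exp (-(u ^ 2) / t) / (t ^ a * Real.Gamma a)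

variable {S : Type*} [Fintype S] [DecidableEq S] [Nonempty S]
  [MeasurableSpace S] [MeasurableSingletonClass S]

set_option linter.unusedSectionVars false

namespace MChain

/-- The trajectory seen from time `1` on. -/
def shift {E : Type*} (ω : ℕ → E) : ℕ → E := fun k => ω (1 + k)

lemma measurable_shift {E : Type*} [MeasurableSpace E] : Measurable (shift : (ℕ → E) → ℕ → E) :=
  measurable_pi_lambda _ fun _ => measurable_pi_apply _

section General

variable {E : Type*} [MeasurableSpace E] [Countable E] [MeasurableSingletonClass E]

lemma ae_init (X : MChain E) (z : E) : ∀ᵐ ω ∂X.P z, ω 0 = z := by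
  have := X.isProb z
  have hm : MeasurableSet {ω : ℕ → E | ω 0 = z} :=
    measurableSet_eq_fun (measurable_pi_apply 0) measurable_const
  exact (mem_ae_iff_prob_eq_one hm).2 (X.init z)

/-- The family of path laws, as a Markov kernel. -/
noncomputable def pathKernel (X : MChain E) : ProbabilityTheory.Kernel E (ℕ → E) :=
  ⟨X.P, measurable_of_countable _⟩

instance (X : MChain E) : ProbabilityTheory.IsMarkovKernel X.pathKernel := ⟨X.isProb⟩

/-- The law of the position at time `1`, as a kernel. -/
noncomputable def stepKernel (X : MChain E) : ProbabilityTheory.Kernel E E :=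
  X.pathKernel.map (fun ω => ω 1)

lemma stepKernel_apply (X : MChain E) (z : E) :
    X.stepKernel z = (X.P z).map (fun ω => ω 1) :=
  ProbabilityTheory.Kernel.map_apply _ (measurable_pi_apply 1) z

lemma map_shift (X : MChain E) (z : E) :
    (X.P z).map shift = (X.pathKernel.comp X.stepKernel) z := by
  ext A hA
  have h1 : Measurable (fun ω : ℕ → E => ω 1) := measurable_pi_apply 1
  have hs : MeasurableSet (shift ⁻¹' A) := measurable_shift hA
  rw [Measure.map_apply measurable_shift hA, ProbabilityTheory.Kernel.comp_apply' _ _ _ hA,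
    stepKernel_apply, lintegral_countable']
  have hU : shift ⁻¹' A = ⋃ w : E, ({ω : ℕ → E | ω 1 = w} ∩ shift ⁻¹' A) := by
    ext ω; simp
  conv_lhs => rw [hU]
  rw [measure_iUnion]
  · refine tsum_congr fun w => ?_
    have := X.markov z 1 w A Set.univ hA (fun _ _ _ _ => trivial)
    simp only [Set.univ_inter] at this
    rw [Measure.map_apply h1 (measurableSet_singleton w), mul_comm]
    exact this
  · intro w w' hww
    refine Set.disjoint_left.2 fun ω h h' => hww ?_
    exact h.1.symm.trans h'.1
  · intro w
    exact (h1 (measurableSet_singleton w)).inter hs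

/-- First step decomposition for nonnegative functionals. -/
lemma lintegral_shift (X : MChain E) (z : E) {F : (ℕ → E) → ℝ≥0∞} (hF : Measurable F) :
    ∫⁻ ω, F (shift ω) ∂X.P z = ∫⁻ ω, (∫⁻ ω', F ω' ∂X.P (ω 1)) ∂X.P z := by
  rw [← lintegral_map hF measurable_shift, map_shift,
    ProbabilityTheory.Kernel.lintegral_comp _ _ _ hF, stepKernel_apply,
    lintegral_map (measurable_of_countable _) (measurable_pi_apply 1)]
  rfl

/-- First step decomposition for integrable functionals. -/
lemma integral_shift (X : MChain E) (z : E) {F : (ℕ → E) → ℝ} (hF : Measurable F)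
    (hi : Integrable (fun ω => F (shift ω)) (X.P z)) :
    ∫ ω, F (shift ω) ∂X.P z = ∫ ω, (∫ ω', F ω' ∂X.P (ω 1)) ∂X.P z := by
  have hi' : Integrable F ((X.pathKernel.comp X.stepKernel) z) := by
    rw [← map_shift, integrable_map_measure hF.aestronglyMeasurable measurable_shift.aemeasurable]
    exact hi
  rw [← integral_map measurable_shift.aemeasurable hF.aestronglyMeasurable, map_shift,
    ProbabilityTheory.Kernel.integral_comp hi', stepKernel_apply,
    integral_map (measurable_pi_apply 1).aemeasurable
      (measurable_of_countable _).aestronglyMeasurable]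
  rfl

end General

end MChain

namespace MChain

/-- The event that the `S`-coordinate avoids `s0` at times `1, …, n`. -/
def alive {S : Type*} (s0 : S) (n : ℕ) : Set (ℕ → ℕ × S) := {ω | ∀ k < n, (ω (k + 1)).2 ≠ s0}

lemma alive_zero {S : Type*} (s0 : S) : alive s0 0 = Set.univ := by
  ext; simp [alive]

lemma mem_alive_succ {S : Type*} (s0 : S) (n : ℕ) (ω : ℕ → ℕ × S) :
    ω ∈ alive s0 (n + 1) ↔ (ω 1).2 ≠ s0 ∧ shift ω ∈ alive s0 n := by
  constructor
  · intro h
    refine ⟨h 0 (by omega), fun k hk => ?_⟩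
    have := h (k + 1) (by omega)
    rwa [add_comm (k + 1) 1] at this
  · rintro ⟨h1, h2⟩ k hk
    rcases k with _ | k
    · exact h1
    · have := h2 k (by omega)
      rw [add_comm (k + 1) 1]
      exact this

lemma measurableSet_alive (s0 : S) (n : ℕ) : MeasurableSet (alive s0 n) := by
  have h : alive s0 n = ⋂ k ∈ Set.Iio n, {ω : ℕ → ℕ × S | (ω (k + 1)).2 ≠ s0} := by
    ext; simp [alive]
  rw [h]
  refine MeasurableSet.biInter (Set.to_countable _) fun k _ => ?_
  have : Measurable (fun ω : ℕ → ℕ × S => (ω (k + 1)).2) :=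
    measurable_snd.comp (measurable_pi_apply _)
  exact this (measurableSet_singleton s0).compl

lemma measurable_eval (n : ℕ) {β : Type*} [MeasurableSpace β] (g : ℕ × S → β) :
    Measurable (fun ω : ℕ → ℕ × S => g (ω n)) :=
  (measurable_of_countable g).comp (measurable_pi_apply n)

/-- The expected value of `g` at time `n`, restricted to paths that have not yet visited `s0`. -/
noncomputable def taboo (X : MChain (ℕ × S)) (s0 : S) (n : ℕ) (g : ℕ × S → ℝ≥0∞)
    (z : ℕ × S) : ℝ≥0∞ :=
  ∫⁻ ω, (alive s0 n).indicator (fun ω => g (ω n)) ω ∂X.P z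

lemma taboo_zero (X : MChain (ℕ × S)) (s0 : S) (g : ℕ × S → ℝ≥0∞) (z : ℕ × S) :
    X.taboo s0 0 g z = g z := by
  have := X.isProb z
  have h : ∀ᵐ ω ∂X.P z, (alive s0 0).indicator (fun ω => g (ω 0)) ω = g z := by
    filter_upwards [X.ae_init z] with ω hω
    simp [alive_zero, hω]
  rw [taboo, lintegral_congr_ae h]
  simp

lemma taboo_one (X : MChain (ℕ × S)) (s0 : S) (n : ℕ) (z : ℕ × S) :
    X.taboo s0 n 1 z = X.P z (alive s0 n) := by
  have : (fun ω : ℕ → ℕ × S => (1 : ℕ × S → ℝ≥0∞) (ω n)) = 1 := rfl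
  rw [taboo, this, lintegral_indicator_one (measurableSet_alive s0 n)]

lemma taboo_succ (X : MChain (ℕ × S)) (s0 : S) (n : ℕ) (g : ℕ × S → ℝ≥0∞) (z : ℕ × S) :
    X.taboo s0 (n + 1) g z
      = ∫⁻ ω, (if (ω 1).2 = s0 then 0 else X.taboo s0 n g (ω 1)) ∂X.P z := by
  set G : (ℕ → ℕ × S) → ℝ≥0∞ := (alive s0 n).indicator (fun ω => g (ω n)) with hG
  have hGm : Measurable G := (measurable_eval n g).indicator (measurableSet_alive s0 n)
  set F : (ℕ → ℕ × S) → ℝ≥0∞ := fun ω => if (ω 0).2 = s0 then 0 else G ω with hF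
  have hFm : Measurable F := by
    have hset : MeasurableSet {ω : ℕ → ℕ × S | (ω 0).2 = s0} :=
      (measurable_eval 0 Prod.snd) (measurableSet_singleton s0)
    exact Measurable.ite hset measurable_const hGm
  have h1 : ∀ ω, (alive s0 (n + 1)).indicator (fun ω => g (ω (n + 1))) ω = F (shift ω) := by
    intro ω
    by_cases h : (ω 1).2 = s0
    · have h' : ω ∉ alive s0 (n + 1) := fun hc => ((mem_alive_succ s0 n ω).1 hc).1 h
      simp [hF, shift, h, h']
    · have h' : ω ∈ alive s0 (n + 1) ↔ shift ω ∈ alive s0 n := by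
        rw [mem_alive_succ]; simp [h]
      have h2 : F (shift ω) = G (shift ω) := by
        rw [hF]
        exact if_neg h
      rw [h2, hG]
      by_cases h3 : shift ω ∈ alive s0 n
      · rw [Set.indicator_of_mem h3, Set.indicator_of_mem (h'.2 h3), add_comm n 1]
        rfl
      · rw [Set.indicator_of_notMem h3, Set.indicator_of_notMem fun hc => h3 (h'.1 hc)]
  rw [taboo, lintegral_congr h1, lintegral_shift X z hFm]
  refine lintegral_congr fun ω => ?_
  have h2 : ∀ᵐ ω' ∂X.P (ω 1), F ω' = if (ω 1).2 = s0 then 0 else G ω' := by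
    filter_upwards [X.ae_init (ω 1)] with ω' h
    simp [hF, h]
  rw [lintegral_congr_ae h2]
  split_ifs <;> simp [taboo, hG]

lemma measure_alive_add_le (X : MChain (ℕ × S)) (s0 : S) {N : ℕ} {ρ : ℝ≥0∞}
    (h : ∀ z, X.P z (alive s0 N) ≤ ρ) (n : ℕ) :
    ∀ z, X.P z (alive s0 (n + N)) ≤ ρ * X.P z (alive s0 n) := by
  induction n with
  | zero =>
    intro z
    have := X.isProb z
    simpa [alive_zero] using h z
  | succ n ih =>
    intro z
    rw [show n + 1 + N = (n + N) + 1 by ring, ← taboo_one, ← taboo_one, taboo_succ, taboo_succ,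
      ← lintegral_const_mul _ (measurable_eval 1
        (fun w => if w.2 = s0 then 0 else X.taboo s0 n 1 w))]
    refine lintegral_mono fun ω => ?_
    dsimp only
    split_ifs
    · simp
    · rw [taboo_one, taboo_one]
      exact ih _

/-- A uniform bound on the probability of a long excursion gives geometric tails. -/
lemma exists_geometric_tail (X : MChain (ℕ × S)) (s0 : S)
    (h : ∃ (N : ℕ) (ρ : ℝ), ρ < 1 ∧ ∀ z, X.P z (alive s0 N) ≤ ENNReal.ofReal ρ) :
    ∃ c θ : ℝ, 0 < c ∧ 0 < θ ∧ θ < 1 ∧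
      ∀ n z, X.P z (alive s0 n) ≤ ENNReal.ofReal (c * θ ^ n) := by
  obtain ⟨N, ρ, hρ, hN⟩ := h
  have hNpos : N ≠ 0 := by
    rintro rfl
    have := hN (0, s0)
    have hp := X.isProb (0, s0)
    rw [alive_zero, measure_univ, ENNReal.one_le_ofReal] at this
    linarith
  set σ : ℝ := max ρ (1 / 2) with hσ
  have hσ0 : 0 < σ := lt_of_lt_of_le (by norm_num) (le_max_right _ _)
  have hσ1 : σ < 1 := max_lt hρ (by norm_num)
  set θ : ℝ := σ ^ ((N : ℝ)⁻¹) with hθ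
  have hθ0 : 0 < θ := Real.rpow_pos_of_pos hσ0 _
  have hθ1 : θ < 1 := Real.rpow_lt_one hσ0.le hσ1 (by positivity)
  have hθN : θ ^ N = σ := Real.rpow_inv_natCast_pow hσ0.le hNpos
  have hNσ : ∀ z, X.P z (alive s0 N) ≤ ENNReal.ofReal σ := fun z =>
    (hN z).trans (ENNReal.ofReal_le_ofReal (le_max_left _ _))
  refine ⟨σ⁻¹, θ, inv_pos.2 hσ0, hθ0, hθ1, fun n => ?_⟩
  induction n using Nat.strong_induction_on with
  | _ n ih =>
    intro z
    have hp := X.isProb z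
    rcases lt_or_ge n N with hn | hn
    · refine prob_le_one.trans (ENNReal.one_le_ofReal.2 ?_)
      have : θ ^ N ≤ θ ^ n := pow_le_pow_of_le_one hθ0.le hθ1.le hn.le
      rw [hθN] at this
      rw [inv_mul_eq_div, le_div_iff₀ hσ0]
      linarith
    · obtain ⟨m, rfl⟩ := Nat.exists_eq_add_of_le' hn
      refine (measure_alive_add_le X s0 hNσ m z).trans ?_
      refine (mul_le_mul_right (ih m (by omega) z) _).trans ?_
      rw [← ENNReal.ofReal_mul hσ0.le, pow_add, hθN]
      exact ENNReal.ofReal_le_ofReal (le_of_eq (by ring))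

end MChain

namespace MChain

lemma edist_natCast_eq (m n : ℕ) : edist m n = ENNReal.ofReal |(m : ℝ) - n| := by
  rw [edist_dist, Nat.dist_eq]

lemma exists_step_moment_bound (X : MChain (ℕ × S)) {p : ℝ} (hp : 0 ≤ p) (hB : CondB X p) :
    ∃ C : ℝ≥0∞, C ≠ ⊤ ∧ ∀ z, ∫⁻ ω, edist (ω 1).1 z.1 ^ p ∂X.P z ≤ C := by
  obtain ⟨C, hC, h⟩ := hB
  refine ⟨C, hC, fun z => le_trans (le_of_eq (lintegral_congr fun ω => ?_)) (h z.1 z.2)⟩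
  rw [edist_natCast_eq, ENNReal.ofReal_rpow_of_nonneg (abs_nonneg _) hp]

lemma measurable_increment (p : ℝ) (k : ℕ) :
    Measurable fun ω : ℕ → ℕ × S => edist (ω k).1 (ω (k + 1)).1 ^ p :=
  ((measurable_eval k Prod.fst).edist (measurable_eval (k + 1) Prod.fst)).pow_const p

lemma lintegral_increment_le (X : MChain (ℕ × S)) {p : ℝ} {C : ℝ≥0∞}
    (hC : ∀ z, ∫⁻ ω, edist (ω 1).1 z.1 ^ p ∂X.P z ≤ C) (k : ℕ) :
    ∀ z, ∫⁻ ω, edist (ω k).1 (ω (k + 1)).1 ^ p ∂X.P z ≤ C := by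
  induction k with
  | zero =>
    intro z
    refine le_trans (le_of_eq (lintegral_congr_ae ?_)) (hC z)
    filter_upwards [X.ae_init z] with ω hω
    rw [hω, edist_comm]
  | succ k ih =>
    intro z
    have := X.isProb z
    set F : (ℕ → ℕ × S) → ℝ≥0∞ := fun ω => edist (ω k).1 (ω (k + 1)).1 ^ p with hF
    have hFm : Measurable F :=
      measurable_increment p k
    have h1 : ∀ ω, edist (ω (k + 1)).1 (ω (k + 1 + 1)).1 ^ p = F (shift ω) := by
      intro ω
      simp only [hF, shift, add_comm 1]
    rw [lintegral_congr h1, lintegral_shift X z hFm]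
    calc _ ≤ ∫⁻ _, C ∂X.P z := lintegral_mono fun ω => ih (ω 1)
      _ = C := by simp

lemma exists_displacement_bound (X : MChain (ℕ × S)) {p : ℝ} (hp : 1 ≤ p) (hB : CondB X p) :
    ∃ C : ℝ≥0∞, C ≠ ⊤ ∧ ∀ (n : ℕ) (z : ℕ × S),
      ∫⁻ ω, (1 + edist (ω n).1 z.1) ^ p ∂X.P z ≤ C * ((n : ℝ≥0∞) + 1) ^ p := by
  obtain ⟨C, hC, h⟩ := exists_step_moment_bound X (by linarith) hB
  refine ⟨2 ^ (p - 1) * (1 + C), ENNReal.mul_ne_top (by simp) (by simp [hC]), fun n z => ?_⟩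
  have := X.isProb z
  have hpt : ∀ᵐ ω ∂X.P z, (1 + edist (ω n).1 z.1) ^ p ≤ 2 ^ (p - 1) *
      (1 + (n : ℝ≥0∞) ^ (p - 1) * ∑ k ∈ Finset.range n, edist (ω k).1 (ω (k + 1)).1 ^ p) := by
    filter_upwards [X.ae_init z] with ω hω
    refine (ENNReal.rpow_add_le_mul_rpow_add_rpow _ _ hp).trans ?_
    rw [ENNReal.one_rpow]
    gcongr
    calc edist (ω n).1 z.1 ^ p
        ≤ (∑ k ∈ Finset.range n, edist (ω k).1 (ω (k + 1)).1) ^ p := by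
          have h0 := edist_le_range_sum_edist (fun k => (ω k).1) n
          rw [hω] at h0
          rw [edist_comm]
          exact ENNReal.rpow_le_rpow h0 (by linarith)
      _ ≤ _ := by
          have h0 := ENNReal.rpow_sum_le_const_mul_sum_rpow (Finset.range n)
            (fun k => edist (ω k).1 (ω (k + 1)).1) hp
          simpa using h0
  have hm : ∀ k, Measurable fun ω : ℕ → ℕ × S => edist (ω k).1 (ω (k + 1)).1 ^ p := fun k =>
    measurable_increment p k
  have hms : Measurable fun ω : ℕ → ℕ × S =>
      ∑ k ∈ Finset.range n, edist (ω k).1 (ω (k + 1)).1 ^ p :=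
    Finset.measurable_sum _ fun k _ => hm k
  refine (lintegral_mono_ae hpt).trans ?_
  rw [lintegral_const_mul _ ((hms.const_mul _).const_add _),
    lintegral_add_left measurable_const, lintegral_const_mul _ hms,
    lintegral_finsetSum _ fun k _ => hm k, mul_assoc]
  gcongr
  have hs : ∑ k ∈ Finset.range n, ∫⁻ ω, edist (ω k).1 (ω (k + 1)).1 ^ p ∂X.P z ≤ n * C := by
    refine (Finset.sum_le_sum fun k _ => lintegral_increment_le X h k z).trans ?_
    simp
  have hn1 : (1 : ℝ≥0∞) ≤ ((n : ℝ≥0∞) + 1) ^ p := by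
    rw [← ENNReal.one_rpow p]
    exact ENNReal.rpow_le_rpow (by simp) (by linarith)
  have hn2 : (n : ℝ≥0∞) ^ (p - 1) * n ≤ ((n : ℝ≥0∞) + 1) ^ p := by
    calc (n : ℝ≥0∞) ^ (p - 1) * n
        ≤ ((n : ℝ≥0∞) + 1) ^ (p - 1) * (n + 1) ^ (1 : ℝ) := by
          rw [ENNReal.rpow_one]
          gcongr <;> exact le_self_add
      _ = _ := by
          rw [← ENNReal.rpow_add_of_nonneg _ _ (by linarith) (by norm_num)]
          simp
  calc (∫⁻ _, 1 ∂X.P z) + (n : ℝ≥0∞) ^ (p - 1) * _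
      ≤ 1 + (n : ℝ≥0∞) ^ (p - 1) * (n * C) := by
        gcongr
        simp
    _ = 1 + ((n : ℝ≥0∞) ^ (p - 1) * n) * C := by rw [mul_assoc]
    _ ≤ ((n : ℝ≥0∞) + 1) ^ p + ((n : ℝ≥0∞) + 1) ^ p * C := by gcongr
    _ = _ := by ring

lemma summable_add_pow_mul_geometric (k : ℕ) {r : ℝ} (hr0 : 0 < r) (hr : r < 1) :
    Summable fun n : ℕ => ((n : ℝ) + 2) ^ k * r ^ n := by
  have h := summable_pow_mul_geometric_of_norm_lt_one (R := ℝ) k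
    (r := r) (by rwa [Real.norm_of_nonneg hr0.le])
  have h2 := ((summable_nat_add_iff 2).2 h).mul_right ((r ^ 2)⁻¹)
  refine h2.congr fun n => ?_
  push_cast
  field_simp
  ring

/-- Moments of the displacement, summed along an excursion away from `s0`, are bounded. -/
lemma exists_excursion_moment_bound (X : MChain (ℕ × S)) (s0 : S) {p q : ℝ} (hp : 1 ≤ p)
    (hq : 0 < q) (hqp : q < p) (hB : CondB X p)
    (hT : ∃ c θ : ℝ, 0 < c ∧ 0 < θ ∧ θ < 1 ∧
      ∀ n z, X.P z (alive s0 n) ≤ ENNReal.ofReal (c * θ ^ n)) :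
    ∃ K : ℝ≥0∞, K ≠ ⊤ ∧ ∀ (l : ℕ) (_ : l ≤ 1) (z : ℕ × S),
      ∑' n, ∫⁻ ω, (alive s0 n).indicator (fun ω => (1 + edist (ω (n + l)).1 z.1) ^ q) ω ∂X.P z
        ≤ K := by
  obtain ⟨c, θ, hc, hθ0, hθ1, hT⟩ := hT
  obtain ⟨C, hC, hD⟩ := exists_displacement_bound X hp hB
  set a : ℝ := q / p with ha
  have hp0 : 0 < p := by linarith
  have ha0 : 0 < a := by positivity
  have ha1 : a < 1 := (div_lt_one hp0).2 hqp
  have hpa : p * a = q := by rw [ha]; field_simp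
  set k : ℕ := ⌈q⌉₊ with hk
  set r : ℝ := θ ^ (1 - a) with hr
  have hr0 : 0 < r := Real.rpow_pos_of_pos hθ0 _
  have hr1 : r < 1 := Real.rpow_lt_one hθ0.le hθ1 (by linarith)
  have hsum := summable_add_pow_mul_geometric k hr0 hr1
  set K₁ : ℝ≥0∞ := C ^ a * ENNReal.ofReal (c ^ (1 - a)) with hK₁
  have hK₁t : K₁ ≠ ⊤ := ENNReal.mul_ne_top (ENNReal.rpow_ne_top_of_nonneg ha0.le hC)
    ENNReal.ofReal_ne_top
  refine ⟨K₁ * ENNReal.ofReal (∑' n : ℕ, ((n : ℝ) + 2) ^ k * r ^ n),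
    ENNReal.mul_ne_top hK₁t ENNReal.ofReal_ne_top, fun l hl z => ?_⟩
  rw [ENNReal.ofReal_tsum_of_nonneg (fun n => by positivity) hsum, ← ENNReal.tsum_mul_left]
  refine ENNReal.tsum_le_tsum fun n => ?_
  have hm1 : Measurable fun ω : ℕ → ℕ × S => (1 + edist (ω (n + l)).1 z.1) ^ p :=
    measurable_eval (n + l) (fun w => (1 + edist w.1 z.1) ^ p)
  have hm2 : Measurable ((alive s0 n).indicator (1 : (ℕ → ℕ × S) → ℝ≥0∞)) :=
    measurable_one.indicator (measurableSet_alive s0 n)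
  have hpt : ∀ ω : ℕ → ℕ × S,
      (alive s0 n).indicator (fun ω => (1 + edist (ω (n + l)).1 z.1) ^ q) ω
        = ((1 + edist (ω (n + l)).1 z.1) ^ p) ^ a
          * ((alive s0 n).indicator (1 : (ℕ → ℕ × S) → ℝ≥0∞) ω) ^ (1 - a) := by
    intro ω
    by_cases h : ω ∈ alive s0 n
    · simp only [Set.indicator_of_mem h, Pi.one_apply, ENNReal.one_rpow, mul_one]
      rw [← ENNReal.rpow_mul, hpa]
    · simp only [Set.indicator_of_notMem h]
      rw [ENNReal.zero_rpow_of_pos (by linarith), mul_zero]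
  rw [lintegral_congr hpt]
  refine (ENNReal.lintegral_mul_norm_pow_le hm1.aemeasurable hm2.aemeasurable ha0.le
    (by linarith : (0 : ℝ) ≤ 1 - a) (by ring)).trans ?_
  rw [lintegral_indicator_one (measurableSet_alive s0 n)]
  have e1 : (∫⁻ ω, (1 + edist (ω (n + l)).1 z.1) ^ p ∂X.P z) ^ a
      ≤ C ^ a * ENNReal.ofReal (((n : ℝ) + 2) ^ k) := by
    calc _ ≤ (C * (((n : ℝ≥0∞) + 2)) ^ p) ^ a := by
          refine ENNReal.rpow_le_rpow ((hD (n + l) z).trans ?_) ha0.le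
          have : ((n + l : ℕ) : ℝ≥0∞) + 1 ≤ (n : ℝ≥0∞) + 2 := by
            exact_mod_cast (by omega : n + l + 1 ≤ n + 2)
          gcongr
      _ = C ^ a * ((n : ℝ≥0∞) + 2) ^ q := by
          rw [ENNReal.mul_rpow_of_nonneg _ _ ha0.le, ← ENNReal.rpow_mul, hpa]
      _ ≤ C ^ a * ((n : ℝ≥0∞) + 2) ^ (k : ℝ) := by
          gcongr
          · exact le_add_left (by norm_num)
          · exact Nat.le_ceil q
      _ = _ := by
          rw [ENNReal.rpow_natCast, ENNReal.ofReal_pow (by positivity),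
            ENNReal.ofReal_add (by positivity) (by norm_num)]
          simp
  have e2 : (X.P z (alive s0 n)) ^ (1 - a)
      ≤ ENNReal.ofReal (c ^ (1 - a)) * ENNReal.ofReal (r ^ n) := by
    refine (ENNReal.rpow_le_rpow (hT n z) (by linarith)).trans (le_of_eq ?_)
    rw [ENNReal.ofReal_rpow_of_nonneg (by positivity) (by linarith),
      ← ENNReal.ofReal_mul (by positivity), Real.mul_rpow hc.le (by positivity),
      ← Real.rpow_natCast, ← Real.rpow_mul hθ0.le, hr, ← Real.rpow_natCast,
      ← Real.rpow_mul hθ0.le, mul_comm (1 - a)]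
  refine (mul_le_mul' e1 e2).trans (le_of_eq ?_)
  rw [ENNReal.ofReal_mul (by positivity), hK₁]
  ring

end MChain

section KilledMatrix

/-- The function obtained from `f` by setting its value at `s0` to zero. -/
def killAt (s0 : S) (f : S → ℝ) (j : S) : ℝ := if j = s0 then 0 else f j

lemma sum_mul_killAt (s0 : S) (w f : S → ℝ) :
    ∑ j, w j * killAt s0 f j = ∑ j, w j * f j - w s0 * f s0 := by
  have : ∀ j, w j * killAt s0 f j = w j * f j - if j = s0 then w j * f j else 0 := by
    intro j
    by_cases h : j = s0 <;> simp [killAt, h]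
  simp [this, Finset.sum_sub_distrib]

lemma sum_stationary {Q : S → S → ℝ} {pst : S → ℝ} (h : IsStationaryDist Q pst) (g : S → ℝ) :
    ∑ i, pst i * ∑ j, Q i j * g j = ∑ j, pst j * g j := by
  simp_rw [Finset.mul_sum]
  rw [Finset.sum_comm]
  refine Finset.sum_congr rfl fun j _ => ?_
  rw [← h.2.2 j, Finset.sum_mul]
  exact Finset.sum_congr rfl fun i _ => by ring

lemma eq_zero_of_le_killed {Q : S → S → ℝ} {pst : S → ℝ} (hs : IsStationaryDist Q pst)
    (hQ : IsStochasticMatrix Q) (hi : IsIrreducibleMatrix Q) (s0 : S) {f : S → ℝ}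
    (hf : ∀ i, 0 ≤ f i) (hle : ∀ i, f i ≤ ∑ j, Q i j * killAt s0 f j) : ∀ i, f i = 0 := by
  have h1 : ∑ i, pst i * f i ≤ ∑ i, pst i * ∑ j, Q i j * killAt s0 f j :=
    Finset.sum_le_sum fun i _ => mul_le_mul_of_nonneg_left (hle i) (hs.1 i).le
  rw [sum_stationary hs, sum_mul_killAt] at h1
  have h2 : f s0 = 0 := by
    have := hs.1 s0
    have := hf s0
    nlinarith
  have hk : killAt s0 f = f := by
    funext j
    by_cases h : j = s0 <;> simp [killAt, h, h2]
  rw [hk] at hle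
  have h3 : ∀ i, f i = ∑ j, Q i j * f j := by
    have h4 : ∑ i, pst i * ((∑ j, Q i j * f j) - f i) = 0 := by
      simp_rw [mul_sub, Finset.sum_sub_distrib]
      rw [sum_stationary hs, sub_self]
    rw [Finset.sum_eq_zero_iff_of_nonneg fun i _ =>
      mul_nonneg (hs.1 i).le (sub_nonneg.2 (hle i))] at h4
    intro i
    have := h4 i (Finset.mem_univ i)
    rcases mul_eq_zero.1 this with h | h
    · exact absurd h (hs.1 i).ne'
    · linarith
  have hpow : ∀ n : ℕ, (∀ i j, 0 ≤ ((Matrix.of Q) ^ n) i j) ∧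
      ∀ i, ∑ j, ((Matrix.of Q) ^ n) i j * f j = f i := by
    intro n
    induction n with
    | zero =>
      refine ⟨fun i j => ?_, fun i => ?_⟩
      · rw [pow_zero, Matrix.one_apply]
        split_ifs <;> norm_num
      · simp [Matrix.one_apply]
    | succ n ih =>
      refine ⟨fun i j => ?_, fun i => ?_⟩
      · rw [pow_succ, Matrix.mul_apply]
        exact Finset.sum_nonneg fun k _ => mul_nonneg (ih.1 i k) (hQ.1 k j)
      · simp_rw [pow_succ, Matrix.mul_apply, Finset.sum_mul]
        rw [Finset.sum_comm, ← ih.2 i]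
        refine Finset.sum_congr rfl fun k _ => ?_
        rw [h3 k, Finset.mul_sum]
        exact Finset.sum_congr rfl fun j _ => by simp only [Matrix.of_apply]; ring
  intro j
  obtain ⟨n, hn⟩ := hi s0 j
  have h5 := (hpow n).2 s0
  rw [h2, Finset.sum_eq_zero_iff_of_nonneg fun k _ => mul_nonneg ((hpow n).1 s0 k) (hf k)] at h5
  rcases mul_eq_zero.1 (h5 j (Finset.mem_univ j)) with h | h
  · exact absurd h hn.ne'
  · exact h

/-- Expected additive functionals of the excursion of the limiting finite chain: the linear system
obtained by conditioning on the first step is solvable, and stationarity gives its value at `s0`. -/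
lemma exists_excursion_sum {Q : S → S → ℝ} {pst : S → ℝ} (hs : IsStationaryDist Q pst)
    (hQ : IsStochasticMatrix Q) (hi : IsIrreducibleMatrix Q) (s0 : S) (g : S → ℝ) :
    ∃ a : S → ℝ, (∀ i, a i = g i + ∑ j, Q i j * killAt s0 a j) ∧
      a s0 = (∑ i, g i * pst i) / pst s0 := by
  let L : (S → ℝ) →ₗ[ℝ] (S → ℝ) :=
    { toFun := fun a i => a i - ∑ j, Q i j * killAt s0 a j
      map_add' := by
        intro a b
        funext i
        simp only [sum_mul_killAt, Pi.add_apply, mul_add, Finset.sum_add_distrib]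
        ring
      map_smul' := by
        intro r a
        funext i
        simp only [sum_mul_killAt, Pi.smul_apply, smul_eq_mul, RingHom.id_apply, mul_sub,
          Finset.mul_sum]
        have : ∀ j, Q i j * (r * a j) = r * (Q i j * a j) := fun j => by ring
        simp only [this] }
  have hinj : Function.Injective L := by
    rw [← LinearMap.ker_eq_bot, LinearMap.ker_eq_bot']
    intro a ha
    have h0 : ∀ i, a i = ∑ j, Q i j * killAt s0 a j := fun i =>
      sub_eq_zero.1 (congrFun ha i)
    have := eq_zero_of_le_killed hs hQ hi s0 (f := fun i => |a i|) (fun i => abs_nonneg _) (by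
      intro i
      rw [h0 i]
      refine (Finset.abs_sum_le_sum_abs _ _).trans (Finset.sum_le_sum fun j _ => ?_)
      rw [abs_mul, abs_of_nonneg (hQ.1 i j)]
      by_cases h : j = s0 <;> simp [killAt, h])
    funext i
    exact abs_eq_zero.1 (this i)
  obtain ⟨a, ha⟩ := (LinearMap.injective_iff_surjective.1 hinj) g
  have h1 : ∀ i, a i = g i + ∑ j, Q i j * killAt s0 a j := fun i => by
    have : a i - ∑ j, Q i j * killAt s0 a j = g i := congrFun ha i
    linarith
  refine ⟨a, h1, ?_⟩
  rw [eq_div_iff (hs.1 s0).ne']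
  have h2 : ∑ i, pst i * a i = ∑ i, pst i * g i + ∑ i, pst i * ∑ j, Q i j * killAt s0 a j := by
    rw [← Finset.sum_add_distrib]
    exact Finset.sum_congr rfl fun i _ => by rw [← mul_add, ← h1 i]
  rw [sum_stationary hs, sum_mul_killAt] at h2
  have h3 : ∑ i, g i * pst i = ∑ i, pst i * g i := Finset.sum_congr rfl fun i _ => mul_comm _ _
  rw [h3]
  linarith

/-- Probability that the limiting finite chain avoids `s0` at times `1, …, n`. -/
def limitTail (Q : S → S → ℝ) (s0 : S) : ℕ → S → ℝ
  | 0 => fun _ => 1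
  | n + 1 => fun i => ∑ j, Q i j * killAt s0 (limitTail Q s0 n) j

lemma killAt_mono (s0 : S) {f g : S → ℝ} (h : ∀ i, f i ≤ g i) (j : S) :
    killAt s0 f j ≤ killAt s0 g j := by
  by_cases hj : j = s0 <;> simp [killAt, hj, h]

lemma killAt_nonneg (s0 : S) {f : S → ℝ} (h : ∀ i, 0 ≤ f i) (j : S) : 0 ≤ killAt s0 f j := by
  by_cases hj : j = s0 <;> simp [killAt, hj, h]

lemma limitTail_nonneg {Q : S → S → ℝ} (hQ : IsStochasticMatrix Q) (s0 : S) (n : ℕ) :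
    ∀ i, 0 ≤ limitTail Q s0 n i := by
  induction n with
  | zero => intro i; exact zero_le_one
  | succ n ih =>
    intro i
    exact Finset.sum_nonneg fun j _ => mul_nonneg (hQ.1 i j) (killAt_nonneg s0 ih j)

lemma limitTail_succ_le {Q : S → S → ℝ} (hQ : IsStochasticMatrix Q) (s0 : S) (n : ℕ) :
    ∀ i, limitTail Q s0 (n + 1) i ≤ limitTail Q s0 n i := by
  induction n with
  | zero =>
    intro i
    calc ∑ j, Q i j * killAt s0 (limitTail Q s0 0) j ≤ ∑ j, Q i j * 1 := by
          refine Finset.sum_le_sum fun j _ => mul_le_mul_of_nonneg_left ?_ (hQ.1 i j)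
          by_cases hj : j = s0 <;> simp [killAt, hj, limitTail]
      _ = 1 := by simp [hQ.2 i]
  | succ n ih =>
    intro i
    exact Finset.sum_le_sum fun j _ =>
      mul_le_mul_of_nonneg_left (killAt_mono s0 ih j) (hQ.1 i j)

lemma tendsto_killAt {ι : Type*} {l : Filter ι} (s0 : S) {f : ι → S → ℝ} {g : S → ℝ}
    (h : ∀ j, Tendsto (fun n => f n j) l (𝓝 (g j))) (j : S) :
    Tendsto (fun n => killAt s0 (f n) j) l (𝓝 (killAt s0 g j)) := by
  by_cases hj : j = s0
  · simp only [killAt, if_pos hj]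
    exact tendsto_const_nhds
  · simpa only [killAt, if_neg hj] using h j

lemma tendsto_limitTail {Q : S → S → ℝ} {pst : S → ℝ} (hs : IsStationaryDist Q pst)
    (hQ : IsStochasticMatrix Q) (hi : IsIrreducibleMatrix Q) (s0 : S) (i : S) :
    Tendsto (fun n => limitTail Q s0 n i) atTop (𝓝 0) := by
  have hlim : ∀ i, Tendsto (fun n => limitTail Q s0 n i) atTop
      (𝓝 (⨅ n, limitTail Q s0 n i)) := fun i =>
    tendsto_atTop_ciInf (antitone_nat_of_succ_le fun n => limitTail_succ_le hQ s0 n i)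
      ⟨0, by rintro _ ⟨n, rfl⟩; exact limitTail_nonneg hQ s0 n i⟩
  set r : S → ℝ := fun i => ⨅ n, limitTail Q s0 n i with hr
  have h1 : ∀ i, r i = ∑ j, Q i j * killAt s0 r j := by
    intro i
    refine tendsto_nhds_unique ((tendsto_add_atTop_iff_nat 1).2 (hlim i)) ?_
    exact tendsto_finsetSum _ fun j _ => (tendsto_killAt s0 hlim j).const_mul _
  have h2 := eq_zero_of_le_killed hs hQ hi s0 (f := r)
    (fun i => ge_of_tendsto' (hlim i) fun n => limitTail_nonneg hQ s0 n i) (fun i => (h1 i).le) i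
  rw [← h2]
  exact hlim i

end KilledMatrix

/-- The weight `max x 1`, a positive version of `x`. -/
noncomputable def weight (x : ℕ) : ℝ := max (x : ℝ) 1

lemma one_le_weight (x : ℕ) : 1 ≤ weight x := le_max_right _ _

lemma weight_pos (x : ℕ) : 0 < weight x := zero_lt_one.trans_le (one_le_weight x)

lemma weight_eventuallyEq : weight =ᶠ[atTop] fun x : ℕ => (x : ℝ) := by
  filter_upwards [eventually_ge_atTop 1] with x hx
  exact max_eq_left (by exact_mod_cast hx)

lemma tendsto_weight : Tendsto weight atTop atTop :=
  (tendsto_congr' weight_eventuallyEq).2 tendsto_natCast_atTop_atTop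

lemma abs_weight_sub_le (x y : ℕ) : |weight y - weight x| ≤ |(y : ℝ) - x| :=
  abs_max_sub_max_le_abs _ _ _

lemma weight_le_mul (x y : ℕ) : weight x ≤ weight y * (1 + |(y : ℝ) - x|) := by
  have h := abs_le.1 (abs_weight_sub_le x y)
  have := one_le_weight y
  nlinarith [abs_nonneg ((y : ℝ) - x), h.1, h.2]

namespace MChain

lemma ofReal_one_add_abs_rpow (m n : ℕ) {q : ℝ} (hq : 0 ≤ q) :
    ENNReal.ofReal ((1 + |(m : ℝ) - n|) ^ q) = (1 + edist m n) ^ q := by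
  rw [← ENNReal.ofReal_rpow_of_nonneg (by positivity) hq,
    ENNReal.ofReal_add zero_le_one (abs_nonneg _), edist_natCast_eq, ENNReal.ofReal_one]

/-- Uniform second moment bound for one step. -/
lemma exists_step_sq_bound (X : MChain (ℕ × S)) {p : ℝ} (hp : 2 < p) (hB : CondB X p) :
    ∃ C : ℝ, 0 < C ∧ ∀ z : ℕ × S,
      Integrable (fun ω => (1 + |((ω 1).1 : ℝ) - z.1|) ^ 2) (X.P z) ∧
      ∫ ω, (1 + |((ω 1).1 : ℝ) - z.1|) ^ 2 ∂X.P z ≤ C := by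
  obtain ⟨C, hC, h⟩ := exists_displacement_bound X (by linarith : 1 ≤ p) hB
  set C' : ℝ≥0∞ := C * (1 + 1) ^ p with hC'
  have hC't : C' ≠ ⊤ := ENNReal.mul_ne_top hC
    (ENNReal.rpow_ne_top_of_nonneg (by linarith) (by norm_num))
  have key : ∀ z : ℕ × S,
      ∫⁻ ω, ENNReal.ofReal ((1 + |((ω 1).1 : ℝ) - z.1|) ^ 2) ∂X.P z ≤ C' := by
    intro z
    have h1 := h 1 z
    rw [Nat.cast_one] at h1
    refine le_trans (lintegral_mono fun ω => ?_) h1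
    have h2 := ofReal_one_add_abs_rpow (ω 1).1 z.1 (zero_le_two : (0 : ℝ) ≤ 2)
    rw [Real.rpow_two] at h2
    rw [h2]
    exact ENNReal.rpow_le_rpow_of_exponent_le le_self_add hp.le
  refine ⟨C'.toReal + 1, by positivity, fun z => ?_⟩
  have hm : AEStronglyMeasurable (fun ω : ℕ → ℕ × S => (1 + |((ω 1).1 : ℝ) - z.1|) ^ 2) (X.P z) :=
    (measurable_eval 1 (fun w : ℕ × S => (1 + |(w.1 : ℝ) - z.1|) ^ 2)).aestronglyMeasurable
  refine ⟨⟨hm, ?_⟩, ?_⟩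
  · rw [hasFiniteIntegral_iff_ofReal (Eventually.of_forall fun ω => by positivity)]
    exact (key z).trans_lt hC't.lt_top
  · rw [integral_eq_lintegral_of_nonneg_ae (Eventually.of_forall fun ω => by positivity) hm]
    have := ENNReal.toReal_mono hC't (key z)
    linarith

lemma integral_snd (X : MChain (ℕ × S)) (x : ℕ) (i : S) (a : S → ℝ) :
    ∫ ω, a (ω 1).2 ∂X.P (x, i) = ∑ j, qhat X x i j * a j := by
  have := X.isProb (x, i)
  have hm : Measurable fun ω : ℕ → ℕ × S => (ω 1).2 := measurable_eval 1 Prod.snd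
  have := Measure.isProbabilityMeasure_map (μ := X.P (x, i)) hm.aemeasurable
  rw [← integral_map (φ := fun ω : ℕ → ℕ × S => (ω 1).2) hm.aemeasurable
    (measurable_of_countable a).aestronglyMeasurable, integral_fintype (Integrable.of_finite)]
  refine Finset.sum_congr rfl fun j _ => ?_
  rw [map_measureReal_apply hm (measurableSet_singleton j), smul_eq_mul]
  rfl

lemma integrable_of_abs_le (X : MChain (ℕ × S)) (z : ℕ × S) {B : ℝ} {f : (ℕ → ℕ × S) → ℝ}
    (hf : Measurable f) (h : ∀ ω, |f ω| ≤ B) : Integrable f (X.P z) := by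
  have := X.isProb z
  exact Integrable.of_bound hf.aestronglyMeasurable B (Eventually.of_forall h)

/-- Expectation after one step of `u`, restricted to the event that `s0` is not visited. -/
noncomputable def tabooStep (X : MChain (ℕ × S)) (s0 : S) (u : ℕ × S → ℝ) (z : ℕ × S) : ℝ :=
  ∫ ω, (if (ω 1).2 = s0 then 0 else u (ω 1)) ∂X.P z

lemma measureReal_alive_succ (X : MChain (ℕ × S)) (s0 : S) (n : ℕ) (z : ℕ × S) :
    (X.P z).real (alive s0 (n + 1))
      = X.tabooStep s0 (fun w => (X.P w).real (alive s0 n)) z := by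
  rw [measureReal_def, ← taboo_one, taboo_succ, tabooStep, ← integral_toReal]
  · refine integral_congr_ae (Eventually.of_forall fun ω => ?_)
    dsimp only
    split_ifs
    · simp
    · rw [taboo_one, measureReal_def]
  · exact (measurable_eval 1 (fun w => if w.2 = s0 then 0 else X.taboo s0 n 1 w)).aemeasurable
  · refine Eventually.of_forall fun ω => ?_
    have := X.isProb (ω 1)
    split_ifs
    · simp
    · rw [taboo_one]
      exact measure_lt_top _ _

lemma tendsto_measureReal_lt (X : MChain (ℕ × S)) {p : ℝ} (hp : 2 < p) (hB : CondB X p) (K : ℕ)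
    (i : S) : Tendsto (fun x : ℕ => (X.P (x, i)).real {ω | (ω 1).1 < K}) atTop (𝓝 0) := by
  obtain ⟨C, hC, h⟩ := exists_step_sq_bound X hp hB
  have hb : Tendsto (fun x : ℕ => ((K : ℝ) + 1) * C / weight x) atTop (𝓝 0) :=
    tendsto_const_nhds.div_atTop tendsto_weight
  refine squeeze_zero (fun x => measureReal_nonneg) (fun x => ?_) hb
  have hms : MeasurableSet {ω : ℕ → ℕ × S | (ω 1).1 < K} :=
    (measurable_eval 1 (fun w : ℕ × S => w.1)) (MeasurableSet.of_discrete (s := Set.Iio K))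
  have := X.isProb (x, i)
  rw [le_div_iff₀ (weight_pos x), ← integral_indicator_one hms, ← integral_mul_const]
  calc _ ≤ ∫ ω, ((K : ℝ) + 1) * (1 + |((ω 1).1 : ℝ) - x|) ^ 2 ∂X.P (x, i) := by
        refine integral_mono (((integrable_const (1 : ℝ)).indicator hms).mul_const _)
          ((h (x, i)).1.const_mul _) fun ω => ?_
        by_cases hω : ω ∈ {ω : ℕ → ℕ × S | (ω 1).1 < K}
        · simp only [Set.indicator_of_mem hω, Pi.one_apply, one_mul]
          have h1 := weight_le_mul x (ω 1).1
          have h2 : weight (ω 1).1 ≤ K + 1 := by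
            have : ((ω 1).1 : ℝ) < K := by exact_mod_cast hω
            exact max_le (by linarith) (by linarith [K.cast_nonneg (α := ℝ)])
          have h3 := abs_nonneg (((ω 1).1 : ℝ) - x)
          have h4 : (1 + |((ω 1).1 : ℝ) - x|) ≤ (1 + |((ω 1).1 : ℝ) - x|) ^ 2 := by nlinarith
          calc weight x ≤ weight (ω 1).1 * (1 + |((ω 1).1 : ℝ) - x|) := h1
            _ ≤ _ := mul_le_mul h2 h4 (by positivity) (by positivity)
        · simp only [Set.indicator_of_notMem hω, zero_mul]
          positivity
    _ = ((K : ℝ) + 1) * ∫ ω, (1 + |((ω 1).1 : ℝ) - x|) ^ 2 ∂X.P (x, i) := integral_const_mul _ _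
    _ ≤ _ := mul_le_mul_of_nonneg_left (h (x, i)).2 (by positivity)

lemma eventually_tail_le (X : MChain (ℕ × S)) (s0 : S) {p : ℝ} (hp : 2 < p) (hB : CondB X p)
    {Q : S → S → ℝ} (hQ : CondQ X Q) (n : ℕ) : ∀ (i : S) (ε : ℝ), 0 < ε →
      ∀ᶠ x : ℕ in atTop, (X.P (x, i)).real (alive s0 n) ≤ limitTail Q s0 n i + ε := by
  induction n with
  | zero =>
    intro i ε hε
    refine Eventually.of_forall fun x => ?_
    have := X.isProb (x, i)
    have := measureReal_le_one (μ := X.P (x, i)) (s := alive s0 0)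
    simp only [limitTail]
    linarith
  | succ n ih =>
    intro i ε hε
    have h1 : ∀ᶠ y : ℕ in atTop, ∀ j, (X.P (y, j)).real (alive s0 n)
        ≤ limitTail Q s0 n j + ε / 2 := eventually_all.2 fun j => ih j (ε / 2) (by linarith)
    obtain ⟨K, hK⟩ := eventually_atTop.1 h1
    set g : S → ℝ := killAt s0 (fun j => limitTail Q s0 n j + ε / 2) with hg
    have hg0 : ∀ j, 0 ≤ g j := killAt_nonneg s0 fun j => by
      have := limitTail_nonneg hQ.2.1 s0 n j
      linarith
    have hub : ∀ x : ℕ, (X.P (x, i)).real (alive s0 (n + 1))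
        ≤ ∑ j, qhat X x i j * g j + (X.P (x, i)).real {ω | (ω 1).1 < K} := by
      intro x
      have := X.isProb (x, i)
      have hms : MeasurableSet {ω : ℕ → ℕ × S | (ω 1).1 < K} :=
        (measurable_eval 1 (fun w : ℕ × S => w.1)) (MeasurableSet.of_discrete (s := Set.Iio K))
      have hi1 : Integrable (fun ω : ℕ → ℕ × S => g (ω 1).2) (X.P (x, i)) :=
        integrable_of_abs_le X _ (B := ∑ j, |g j|) (measurable_eval 1 fun w : ℕ × S => g w.2)
          fun ω => Finset.single_le_sum (f := fun j => |g j|) (fun j _ => abs_nonneg _)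
            (Finset.mem_univ (ω 1).2)
      have hi2 : Integrable ({ω : ℕ → ℕ × S | (ω 1).1 < K}.indicator (1 : (ℕ → ℕ × S) → ℝ))
          (X.P (x, i)) := (integrable_const (1 : ℝ)).indicator hms
      rw [measureReal_alive_succ, ← integral_snd, ← integral_indicator_one hms,
        ← integral_add hi1 hi2, tabooStep]
      refine integral_mono (integrable_of_abs_le X _ (B := 1) (measurable_eval 1 fun w : ℕ × S =>
        if w.2 = s0 then 0 else (X.P w).real (alive s0 n)) fun ω => ?_) (hi1.add hi2) fun ω => ?_
      · have := X.isProb (ω 1)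
        split_ifs
        · simp
        · rw [abs_of_nonneg measureReal_nonneg]
          exact measureReal_le_one
      · have := X.isProb (ω 1)
        dsimp only
        have hgω := hg0 (ω 1).2
        by_cases hω : ω ∈ {ω : ℕ → ℕ × S | (ω 1).1 < K}
        · rw [Set.indicator_of_mem hω, Pi.one_apply]
          split_ifs
          · linarith
          · have := measureReal_le_one (μ := X.P (ω 1)) (s := alive s0 n)
            linarith
        · rw [Set.indicator_of_notMem hω, add_zero]
          split_ifs with hs
          · exact hgω
          · have h2 := hK (ω 1).1 (not_lt.1 hω) (ω 1).2
            rw [hg]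
            simpa only [killAt, if_neg hs] using h2
    have hlim : Tendsto (fun x : ℕ => ∑ j, qhat X x i j * g j
        + (X.P (x, i)).real {ω | (ω 1).1 < K}) atTop (𝓝 (∑ j, Q i j * g j + 0)) :=
      (tendsto_finsetSum _ fun j _ => (hQ.1 i j).mul_const _).add
        (tendsto_measureReal_lt X hp hB K i)
    have hlt : ∑ j, Q i j * g j + 0 < limitTail Q s0 (n + 1) i + ε := by
      have : ∑ j, Q i j * g j
          ≤ ∑ j, (Q i j * killAt s0 (limitTail Q s0 n) j + Q i j * (ε / 2)) := by
        refine Finset.sum_le_sum fun j _ => ?_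
        rw [← mul_add]
        refine mul_le_mul_of_nonneg_left ?_ (hQ.2.1.1 i j)
        by_cases hj : j = s0 <;> simp [hg, killAt, hj]
        linarith
      rw [Finset.sum_add_distrib, ← Finset.sum_mul, hQ.2.1.2 i] at this
      simp only [limitTail]
      linarith
    filter_upwards [hlim.eventually_lt_const hlt] with x hx
    exact (hub x).trans hx.le

lemma alive_antitone (s0 : S) {m n : ℕ} (h : m ≤ n) : alive s0 n ⊆ alive s0 m :=
  fun _ hω k hk => hω k (hk.trans_le h)

lemma exists_alive_lt_one (X : MChain (ℕ × S)) (hirr : X.Irreducible) (s0 : S) (z : ℕ × S) :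
    ∃ n, X.P z (alive s0 n) < 1 := by
  have hp := X.isProb z
  obtain ⟨w, hw, n, hn⟩ : ∃ w : ℕ × S, w.2 = s0 ∧ ∃ n, X.P z {ω | ω (n + 1) = w} ≠ 0 := by
    have h0 : ∀ w : ℕ × S, w ≠ z → X.P z {ω | ω 0 = w} = 0 := by
      intro w hw
      have h1 : ∀ᵐ ω ∂X.P z, ω ∉ {ω : ℕ → ℕ × S | ω 0 = w} := by
        filter_upwards [X.ae_init z] with ω hω hc
        exact hw (hc.symm.trans hω)
      simpa using measure_eq_zero_iff_ae_notMem.2 h1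
    obtain ⟨w, hw, hwz⟩ : ∃ w : ℕ × S, w.2 = s0 ∧ w ≠ z := by
      refine ⟨(z.1 + 1, s0), rfl, fun h => ?_⟩
      have := congrArg Prod.fst h
      simp at this
    obtain ⟨n, hn⟩ := hirr z w
    rcases n with _ | n
    · exact absurd (h0 w hwz) hn
    · exact ⟨w, hw, n, hn⟩
  refine ⟨n + 1, ?_⟩
  have hm : MeasurableSet {ω : ℕ → ℕ × S | ω (n + 1) = w} :=
    measurableSet_eq_fun (measurable_pi_apply (n + 1)) measurable_const
  have hsub : alive s0 (n + 1) ⊆ {ω : ℕ → ℕ × S | ω (n + 1) = w}ᶜ := fun ω hω hc =>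
    hω n (by omega) (by rw [show ω (n + 1) = w from hc, hw])
  refine (measure_mono hsub).trans_lt ?_
  rw [prob_compl_eq_one_sub hm]
  exact ENNReal.sub_lt_self ENNReal.one_ne_top one_ne_zero hn

lemma exists_uniform_tail (X : MChain (ℕ × S)) (hirr : X.Irreducible) (s0 : S) {p : ℝ}
    (hp : 2 < p) (hB : CondB X p) {Q : S → S → ℝ} {pst : S → ℝ} (hQ : CondQ X Q)
    (hpst : IsStationaryDist Q pst) :
    ∃ (N : ℕ) (ρ : ℝ), ρ < 1 ∧ ∀ z, X.P z (alive s0 N) ≤ ENNReal.ofReal ρ := by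
  have h1 : ∀ᶠ n in atTop, ∀ i, limitTail Q s0 n i < 1 / 4 := eventually_all.2 fun i =>
    (tendsto_limitTail hpst hQ.2.1 hQ.2.2 s0 i).eventually_lt_const (by norm_num)
  obtain ⟨N₁, hN₁⟩ := h1.exists
  have h2 : ∀ᶠ x : ℕ in atTop, ∀ i, (X.P (x, i)).real (alive s0 N₁) ≤ limitTail Q s0 N₁ i + 1 / 4 :=
    eventually_all.2 fun i => eventually_tail_le X s0 hp hB hQ N₁ i _ (by norm_num)
  obtain ⟨x₀, hx₀⟩ := eventually_atTop.1 h2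
  choose m hm using exists_alive_lt_one X hirr s0
  set B : Finset (ℕ × S) := Finset.range x₀ ×ˢ Finset.univ with hBdef
  set N : ℕ := max N₁ (B.sup m) with hN
  set σ : ℝ≥0∞ := max (2⁻¹) (B.sup fun z => X.P z (alive s0 N)) with hσ
  have hσ1 : σ < 1 := by
    refine max_lt (by simp) ((Finset.sup_lt_iff (by simp)).2 fun z hz => ?_)
    exact (measure_mono (alive_antitone s0
      ((Finset.le_sup (f := m) hz).trans (le_max_right _ _)))).trans_lt (hm z)
  refine ⟨N, σ.toReal, ?_, fun z => ?_⟩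
  · simpa using (ENNReal.toReal_lt_toReal hσ1.ne_top ENNReal.one_ne_top).2 hσ1
  · rw [ENNReal.ofReal_toReal hσ1.ne_top]
    by_cases hz : z ∈ B
    · exact (Finset.le_sup (f := fun z => X.P z (alive s0 N)) hz).trans (le_max_right _ _)
    · have hz' : x₀ ≤ z.1 := by
        by_contra hc
        exact hz (by simp [hBdef, not_le.1 hc])
      refine le_trans ?_ (le_max_left _ _)
      have hpz := X.isProb z
      refine (measure_mono (alive_antitone s0 (le_max_left N₁ _))).trans ?_
      rw [← ENNReal.ofReal_toReal (measure_ne_top (X.P z) (alive s0 N₁))]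
      have h3 := hx₀ z.1 hz' z.2
      have h4 := hN₁ z.2
      calc ENNReal.ofReal ((X.P z).real (alive s0 N₁)) ≤ ENNReal.ofReal (2⁻¹) := by
            apply ENNReal.ofReal_le_ofReal
            have : (z.1, z.2) = z := rfl
            rw [this] at h3
            linarith
        _ = 2⁻¹ := by
            rw [ENNReal.ofReal_inv_of_pos (by norm_num)]
            simp

end MChain

namespace MChain

section ReturnTime

variable {T : Type*} (s0 : T) (ω : ℕ → ℕ × T)

lemma tauRet_eq_zero_iff : tauRet s0 ω = 0 ↔ ∀ n, ω ∈ alive s0 n := by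
  constructor
  · intro h n k _ hs
    rcases Nat.sInf_eq_zero.1 h with h0 | h0
    · exact absurd h0.1 (by norm_num)
    · have : k + 1 ∈ {n | 1 ≤ n ∧ (ω n).2 = s0} := ⟨by omega, hs⟩
      rw [h0] at this
      exact this
  · intro h
    refine Nat.sInf_eq_zero.2 (Or.inr (Set.eq_empty_iff_forall_notMem.2 ?_))
    rintro n ⟨hn, hs⟩
    obtain ⟨k, rfl⟩ := Nat.exists_eq_add_of_le' hn
    exact h (k + 1) k (by omega) hs

lemma tauRet_eq_succ_iff (n : ℕ) :
    tauRet s0 ω = n + 1 ↔ ω ∈ alive s0 n ∧ (ω (n + 1)).2 = s0 := by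
  constructor
  · intro h
    have hne : {n | 1 ≤ n ∧ (ω n).2 = s0}.Nonempty :=
      Nat.nonempty_of_pos_sInf (by
        change 0 < tauRet s0 ω
        omega)
    refine ⟨fun k hk hs => ?_, ?_⟩
    · have : k + 1 < sInf {n | 1 ≤ n ∧ (ω n).2 = s0} := by
        change k + 1 < tauRet s0 ω
        omega
      exact Nat.notMem_of_lt_sInf this ⟨by omega, hs⟩
    · have h1 : (ω (tauRet s0 ω)).2 = s0 := (Nat.sInf_mem hne).2
      rwa [h] at h1
  · rintro ⟨h1, h2⟩
    have hmem : n + 1 ∈ {n | 1 ≤ n ∧ (ω n).2 = s0} := ⟨by omega, h2⟩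
    refine le_antisymm (Nat.sInf_le hmem) ?_
    by_contra hlt
    have h3 := Nat.sInf_mem (⟨_, hmem⟩ : {n | 1 ≤ n ∧ (ω n).2 = s0}.Nonempty)
    obtain ⟨k, hk⟩ := Nat.exists_eq_add_of_le' h3.1
    refine h1 k ?_ (by rw [← hk]; exact h3.2)
    have : sInf {n | 1 ≤ n ∧ (ω n).2 = s0} < n + 1 := not_le.1 hlt
    omega

/-- The `ℕ`-coordinate at the first return of the `S`-coordinate to `s0`. -/
noncomputable def returnPos : ℕ := (ω (tauRet s0 ω)).1

lemma returnPos_eq (h : tauRet s0 ω ≠ 0) [DecidableEq T] :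
    returnPos s0 ω = if (ω 1).2 = s0 then (ω 1).1 else returnPos s0 (shift ω) := by
  obtain ⟨n, hn⟩ := Nat.exists_eq_succ_of_ne_zero h
  split_ifs with h1
  · have h0 : tauRet s0 ω = 0 + 1 := (tauRet_eq_succ_iff s0 ω 0).2 ⟨by simp [alive_zero], h1⟩
    rw [returnPos, h0]
  · have h2 := (tauRet_eq_succ_iff s0 ω n).1 hn
    rcases n with _ | n
    · exact absurd h2.2 h1
    · have h3 : tauRet s0 (shift ω) = n + 1 :=
        (tauRet_eq_succ_iff s0 _ n).2 ⟨((mem_alive_succ s0 n ω).1 h2.1).2, by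
          rw [shift, add_comm]
          exact h2.2⟩
      rw [returnPos, returnPos, hn, h3, shift, add_comm 1 (n + 1)]

end ReturnTime

lemma measurable_tauRet (s0 : S) : Measurable (tauRet s0 : (ℕ → ℕ × S) → ℕ) := by
  refine measurable_to_countable' fun n => ?_
  rcases n with _ | n
  · have : tauRet s0 ⁻¹' {0} = ⋂ n, alive s0 n := by
      ext ω
      simp only [Set.mem_preimage, Set.mem_singleton_iff, Set.mem_iInter]
      exact tauRet_eq_zero_iff s0 ω
    rw [this]
    exact MeasurableSet.iInter fun n => measurableSet_alive s0 n
  · have : tauRet s0 ⁻¹' {n + 1} = alive s0 n ∩ {ω : ℕ → ℕ × S | (ω (n + 1)).2 = s0} := by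
      ext ω
      exact tauRet_eq_succ_iff s0 ω n
    rw [this]
    exact (measurableSet_alive s0 n).inter
      ((measurable_eval (n + 1) Prod.snd) (measurableSet_singleton s0))

lemma measurable_returnPos (s0 : S) : Measurable (returnPos s0 : (ℕ → ℕ × S) → ℕ) := by
  have h1 : Measurable fun q : ℕ × (ℕ → ℕ × S) => (q.2 q.1).1 :=
    measurable_from_prod_countable_right fun n => measurable_eval n Prod.fst
  exact h1.comp ((measurable_tauRet s0).prodMk measurable_id)

lemma ae_tauRet_ne_zero (X : MChain (ℕ × S)) (s0 : S)
    (hT : ∃ c θ : ℝ, 0 < c ∧ 0 < θ ∧ θ < 1 ∧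
      ∀ n z, X.P z (alive s0 n) ≤ ENNReal.ofReal (c * θ ^ n)) (z : ℕ × S) :
    ∀ᵐ ω ∂X.P z, tauRet s0 ω ≠ 0 := by
  obtain ⟨c, θ, hc, hθ0, hθ1, hT⟩ := hT
  have h0 : X.P z (⋂ n, alive s0 n) = 0 := by
    have hlim : Tendsto (fun n : ℕ => ENNReal.ofReal (c * θ ^ n)) atTop (𝓝 0) := by
      have := ((tendsto_pow_atTop_nhds_zero_of_lt_one hθ0.le hθ1).const_mul c)
      rw [mul_zero] at this
      simpa using ENNReal.tendsto_ofReal this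
    exact le_antisymm (ge_of_tendsto' hlim fun n =>
      (measure_mono (Set.iInter_subset _ n)).trans (hT n z)) zero_le
  filter_upwards [measure_eq_zero_iff_ae_notMem.1 h0] with ω hω hc
  exact hω (Set.mem_iInter.2 ((tauRet_eq_zero_iff s0 ω).1 hc))

lemma lintegral_returnPos_le (X : MChain (ℕ × S)) (s0 : S) {q : ℝ} {K : ℝ≥0∞}
    (hT : ∀ z, ∀ᵐ ω ∂X.P z, tauRet s0 ω ≠ 0)
    (hK : ∀ (l : ℕ) (_ : l ≤ 1) (z : ℕ × S),
      ∑' n, ∫⁻ ω, (alive s0 n).indicator (fun ω => (1 + edist (ω (n + l)).1 z.1) ^ q) ω ∂X.P z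
        ≤ K) (z : ℕ × S) :
    ∫⁻ ω, (1 + edist (returnPos s0 ω) z.1) ^ q ∂X.P z ≤ K := by
  refine le_trans ?_ (hK 1 le_rfl z)
  rw [← lintegral_tsum fun n =>
    ((measurable_eval (n + 1) (fun w => (1 + edist w.1 z.1) ^ q)).indicator
      (measurableSet_alive s0 n)).aemeasurable]
  refine lintegral_mono_ae ?_
  filter_upwards [hT z] with ω hω
  obtain ⟨n, hn⟩ := Nat.exists_eq_succ_of_ne_zero hω
  have h := (tauRet_eq_succ_iff s0 ω n).1 hn
  refine le_trans (le_of_eq ?_) (ENNReal.le_tsum n)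
  rw [Set.indicator_of_mem h.1, returnPos, hn]

/-- Mean displacement over an excursion. -/
noncomputable def excMean (X : MChain (ℕ × S)) (s0 : S) (z : ℕ × S) : ℝ :=
  ∫ ω, ((returnPos s0 ω : ℝ) - z.1) ∂X.P z

/-- Mean square displacement over an excursion. -/
noncomputable def excSq (X : MChain (ℕ × S)) (s0 : S) (z : ℕ × S) : ℝ :=
  ∫ ω, ((returnPos s0 ω : ℝ) - z.1) ^ 2 ∂X.P z

lemma exists_returnPos_sq_bound (X : MChain (ℕ × S)) (s0 : S) {q : ℝ} (hq : 2 ≤ q) {K : ℝ≥0∞}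
    (hKt : K ≠ ⊤) (hK : ∀ z, ∫⁻ ω, (1 + edist (returnPos s0 ω) z.1) ^ q ∂X.P z ≤ K) :
    ∃ B : ℝ, ∀ z : ℕ × S,
      MemLp (fun ω => (returnPos s0 ω : ℝ) - z.1) 2 (X.P z) ∧
      |X.excMean s0 z| ≤ B ∧ |X.excSq s0 z| ≤ B := by
  refine ⟨K.toReal, fun z => ?_⟩
  have hpz := X.isProb z
  have hm : Measurable fun ω : ℕ → ℕ × S => (returnPos s0 ω : ℝ) - z.1 :=
    (measurable_of_countable (fun n : ℕ => (n : ℝ) - z.1)).comp (measurable_returnPos s0)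
  have key : ∫⁻ ω, ENNReal.ofReal ((1 + |(returnPos s0 ω : ℝ) - z.1|) ^ 2) ∂X.P z ≤ K := by
    refine le_trans (lintegral_mono fun ω => ?_) (hK z)
    have h2 := ofReal_one_add_abs_rpow (returnPos s0 ω) z.1 (zero_le_two : (0 : ℝ) ≤ 2)
    rw [Real.rpow_two] at h2
    rw [h2]
    exact ENNReal.rpow_le_rpow_of_exponent_le le_self_add hq
  have hm2 : AEStronglyMeasurable
      (fun ω => (1 + |(returnPos s0 ω : ℝ) - z.1|) ^ 2) (X.P z) := by
    have : Measurable fun ω : ℕ → ℕ × S => (1 + |(returnPos s0 ω : ℝ) - z.1|) ^ 2 :=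
      (measurable_of_countable (fun n : ℕ => (1 + |(n : ℝ) - z.1|) ^ 2)).comp
        (measurable_returnPos s0)
    exact this.aestronglyMeasurable
  have hI : Integrable (fun ω => (1 + |(returnPos s0 ω : ℝ) - z.1|) ^ 2) (X.P z) := by
    refine ⟨hm2, ?_⟩
    rw [hasFiniteIntegral_iff_ofReal (Eventually.of_forall fun ω => by positivity)]
    exact key.trans_lt hKt.lt_top
  have hIK : ∫ ω, (1 + |(returnPos s0 ω : ℝ) - z.1|) ^ 2 ∂X.P z ≤ K.toReal := by
    rw [integral_eq_lintegral_of_nonneg_ae (Eventually.of_forall fun ω => by positivity) hm2]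
    exact ENNReal.toReal_mono hKt key
  have b2 : ∀ t : ℝ, |t ^ 2| ≤ (1 + |t|) ^ 2 := fun t => by
    rw [abs_pow]
    exact pow_le_pow_left₀ (abs_nonneg t) (by linarith) 2
  have b1 : ∀ t : ℝ, |t| ≤ (1 + |t|) ^ 2 := fun t => by nlinarith [abs_nonneg t]
  refine ⟨(memLp_two_iff_integrable_sq hm.aestronglyMeasurable).2 (hI.mono'
      (hm.pow_const 2).aestronglyMeasurable (Eventually.of_forall fun ω => b2 _)), ?_, ?_⟩
  · exact (norm_integral_le_of_norm_le (f := fun ω => ((returnPos s0 ω : ℝ) - z.1)) hI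
      (Eventually.of_forall fun ω => b1 ((returnPos s0 ω : ℝ) - z.1))).trans hIK
  · exact (norm_integral_le_of_norm_le (f := fun ω => ((returnPos s0 ω : ℝ) - z.1) ^ 2) hI
      (Eventually.of_forall fun ω => b2 ((returnPos s0 ω : ℝ) - z.1))).trans hIK

/-- First step equations for the first two moments of the excursion displacement. -/
lemma excursion_equations (X : MChain (ℕ × S)) (s0 : S)
    (hT : ∀ z, ∀ᵐ ω ∂X.P z, tauRet s0 ω ≠ 0)
    (hL : ∀ z : ℕ × S, MemLp (fun ω => (returnPos s0 ω : ℝ) - z.1) 2 (X.P z))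
    (hS : ∀ z : ℕ × S, MemLp (fun ω => ((ω 1).1 : ℝ) - z.1) 2 (X.P z)) (x : ℕ) (i : S) :
    X.excMean s0 (x, i) = stepMoment X 1 x i + X.tabooStep s0 (X.excMean s0) (x, i) ∧
    X.excSq s0 (x, i) = stepMoment X 2 x i
      + 2 * ∫ ω, (((ω 1).1 : ℝ) - x) * (if (ω 1).2 = s0 then 0 else X.excMean s0 (ω 1))
          ∂X.P (x, i)
      + X.tabooStep s0 (X.excSq s0) (x, i) := by
  have hpz := X.isProb (x, i)
  set F : (ℕ → ℕ × S) → ℝ := fun ω =>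
    if (ω 0).2 = s0 then 0 else (returnPos s0 ω : ℝ) - (ω 0).1 with hF
  have hset : MeasurableSet {ω : ℕ → ℕ × S | (ω 0).2 = s0} :=
    (measurable_eval 0 Prod.snd) (measurableSet_singleton s0)
  have hFm : Measurable F := Measurable.ite hset measurable_const
    (((measurable_of_countable (fun n : ℕ => (n : ℝ))).comp (measurable_returnPos s0)).sub
      (measurable_eval 0 fun w : ℕ × S => (w.1 : ℝ)))
  have hae : (fun ω => (returnPos s0 ω : ℝ) - x)
      =ᵐ[X.P (x, i)] fun ω => (((ω 1).1 : ℝ) - x) + F (shift ω) := by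
    filter_upwards [hT (x, i)] with ω hω
    rw [returnPos_eq s0 ω hω]
    simp only [hF, shift, add_zero]
    split_ifs <;> ring
  have hΔ := hS (x, i)
  have hD : MemLp (fun ω => F (shift ω)) 2 (X.P (x, i)) := by
    refine ((hL (x, i)).sub hΔ).ae_eq ?_
    filter_upwards [hae] with ω hω
    simp only [Pi.sub_apply, hω]
    ring
  have hae2 : (fun ω => ((returnPos s0 ω : ℝ) - x) ^ 2)
      =ᵐ[X.P (x, i)] fun ω => (((ω 1).1 : ℝ) - x) ^ 2
        + 2 * ((((ω 1).1 : ℝ) - x) * F (shift ω)) + F (shift ω) ^ 2 := by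
    filter_upwards [hae] with ω hω
    rw [hω]
    ring
  have hinner : ∀ w : ℕ × S, ∀ᵐ ω ∂X.P w,
      F ω = if w.2 = s0 then 0 else (returnPos s0 ω : ℝ) - w.1 := by
    intro w
    filter_upwards [X.ae_init w] with ω hω
    simp only [hF, hω]
  have h1 : ∫ ω, F (shift ω) ∂X.P (x, i) = X.tabooStep s0 (X.excMean s0) (x, i) := by
    rw [integral_shift X (x, i) hFm (hD.integrable one_le_two), tabooStep]
    refine integral_congr_ae (Eventually.of_forall fun ω => ?_)
    dsimp only
    rw [integral_congr_ae (hinner (ω 1))]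
    split_ifs
    · simp
    · rfl
  have h2 : ∫ ω, F (shift ω) ^ 2 ∂X.P (x, i) = X.tabooStep s0 (X.excSq s0) (x, i) := by
    rw [integral_shift X (x, i) (F := fun ω => F ω ^ 2) (hFm.pow_const 2) hD.integrable_sq,
      tabooStep]
    refine integral_congr_ae (Eventually.of_forall fun ω => ?_)
    dsimp only
    rw [integral_congr_ae ((hinner (ω 1)).mono fun ω' h => congrArg (· ^ 2) h)]
    split_ifs
    · simp
    · rfl
  have hcross : Integrable (fun ω => (((ω 1).1 : ℝ) - x) * F (shift ω)) (X.P (x, i)) :=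
    hΔ.integrable_mul hD
  have h3 : ∫ ω, (((ω 1).1 : ℝ) - x) * F (shift ω) ∂X.P (x, i)
      = ∫ ω, (((ω 1).1 : ℝ) - x) * (if (ω 1).2 = s0 then 0 else X.excMean s0 (ω 1))
          ∂X.P (x, i) := by
    have h4 := integral_shift X (x, i) (F := fun ω => (((ω 0).1 : ℝ) - x) * F ω)
      ((measurable_eval 0 fun w : ℕ × S => (w.1 : ℝ) - x).mul hFm) hcross
    refine Eq.trans h4 ?_
    refine integral_congr_ae (Eventually.of_forall fun ω => ?_)
    dsimp only
    have h5 : ∀ᵐ ω' ∂X.P (ω 1), (((ω' 0).1 : ℝ) - x) * F ω' = (((ω 1).1 : ℝ) - x) *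
        (if (ω 1).2 = s0 then 0 else (returnPos s0 ω' : ℝ) - (ω 1).1) := by
      filter_upwards [hinner (ω 1), X.ae_init (ω 1)] with ω' h h'
      rw [h, h']
    rw [integral_congr_ae h5, integral_const_mul]
    split_ifs
    · simp
    · rfl
  constructor
  · rw [excMean, integral_congr_ae hae,
      integral_add (hΔ.integrable one_le_two) (hD.integrable one_le_two), h1]
    simp [stepMoment]
  · have hΔ2 : Integrable (fun ω => (((ω 1).1 : ℝ) - x) ^ 2) (X.P (x, i)) := hΔ.integrable_sq
    have hadd : Integrable (fun ω => (((ω 1).1 : ℝ) - x) ^ 2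
        + 2 * ((((ω 1).1 : ℝ) - x) * F (shift ω))) (X.P (x, i)) := hΔ2.add (hcross.const_mul 2)
    rw [excSq, integral_congr_ae hae2, integral_add hadd hD.integrable_sq,
      integral_add hΔ2 (hcross.const_mul 2), h2, integral_const_mul, h3]
    rfl

end MChain

/-- A nonnegative function on `ℕ` that grows at most quadratically in the displacement. -/
def SlowlyVarying (ρ : ℕ → ℝ) : Prop :=
  (∀ x, 0 ≤ ρ x) ∧ ∀ x y : ℕ, ρ y ≤ ρ x * (1 + |(y : ℝ) - x|) ^ 2

lemma SlowlyVarying.add {ρ σ : ℕ → ℝ} (hρ : SlowlyVarying ρ) (hσ : SlowlyVarying σ) :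
    SlowlyVarying fun x => ρ x + σ x :=
  ⟨fun x => add_nonneg (hρ.1 x) (hσ.1 x), fun x y => by
    have h1 := hρ.2 x y
    have h2 := hσ.2 x y
    rw [add_mul]
    linarith⟩

lemma SlowlyVarying.const_mul {ρ : ℕ → ℝ} (hρ : SlowlyVarying ρ) {c : ℝ} (hc : 0 ≤ c) :
    SlowlyVarying fun x => c * ρ x :=
  ⟨fun x => mul_nonneg hc (hρ.1 x), fun x y => by
    rw [mul_assoc]
    exact mul_le_mul_of_nonneg_left (hρ.2 x y) hc⟩

lemma slowlyVarying_weight_rpow {α : ℝ} (h0 : 0 ≤ α) (h2 : α ≤ 2) :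
    SlowlyVarying fun x => weight x ^ (-α) := by
  refine ⟨fun x => (Real.rpow_pos_of_pos (weight_pos x) _).le, fun x y => ?_⟩
  have h1 : 1 ≤ 1 + |(y : ℝ) - x| := by linarith [abs_nonneg ((y : ℝ) - x)]
  have hx := weight_pos x
  have hy := weight_pos y
  have h3 : weight x ^ α ≤ weight y ^ α * (1 + |(y : ℝ) - x|) ^ 2 := by
    calc weight x ^ α ≤ (weight y * (1 + |(y : ℝ) - x|)) ^ α :=
          Real.rpow_le_rpow hx.le (weight_le_mul x y) h0
      _ = weight y ^ α * (1 + |(y : ℝ) - x|) ^ α := Real.mul_rpow hy.le (by linarith)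
      _ ≤ weight y ^ α * (1 + |(y : ℝ) - x|) ^ 2 := by
          refine mul_le_mul_of_nonneg_left ?_ (Real.rpow_nonneg hy.le _)
          rw [← Real.rpow_two]
          exact Real.rpow_le_rpow_of_exponent_le h1 h2
  have hxa := Real.rpow_pos_of_pos hx α
  have hya := Real.rpow_pos_of_pos hy α
  dsimp only
  rw [Real.rpow_neg hx.le, Real.rpow_neg hy.le, inv_mul_eq_div, le_div_iff₀ hxa,
    inv_mul_le_iff₀ hya]
  exact h3

namespace MChain

lemma measure_alive_succ (X : MChain (ℕ × S)) (s0 : S) (n : ℕ) (z : ℕ × S) :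
    X.P z (alive s0 (n + 1))
      = ∫⁻ ω, (if (ω 1).2 = s0 then 0 else X.P (ω 1) (alive s0 n)) ∂X.P z := by
  simp_rw [← taboo_one, taboo_succ]

/-- The Green function of the chain killed at `s0` satisfies the first step equation. -/
lemma tsum_taboo (X : MChain (ℕ × S)) (s0 : S) (g : ℕ × S → ℝ≥0∞) (z : ℕ × S) :
    ∑' n, X.taboo s0 n g z
      = g z + ∫⁻ ω, (if (ω 1).2 = s0 then 0 else ∑' n, X.taboo s0 n g (ω 1)) ∂X.P z := by
  rw [tsum_eq_zero_add' ENNReal.summable, taboo_zero]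
  simp_rw [taboo_succ]
  rw [← lintegral_tsum fun n =>
    (measurable_eval 1 fun w => if w.2 = s0 then 0 else X.taboo s0 n g w).aemeasurable]
  congr 1
  refine lintegral_congr fun ω => ?_
  split_ifs <;> simp

/-- A bounded function is dominated by the Green potential of its defect in the first step
equation. -/
lemma le_tsum_taboo (X : MChain (ℕ × S)) (s0 : S)
    (hT : ∃ c θ : ℝ, 0 < c ∧ 0 < θ ∧ θ < 1 ∧
      ∀ n z, X.P z (alive s0 n) ≤ ENNReal.ofReal (c * θ ^ n))
    {U g : ℕ × S → ℝ≥0∞} {B : ℝ≥0∞} (hBt : B ≠ ⊤) (hB : ∀ z, U z ≤ B)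
    (hU : ∀ z, U z ≤ g z + ∫⁻ ω, (if (ω 1).2 = s0 then 0 else U (ω 1)) ∂X.P z) (z : ℕ × S) :
    U z ≤ ∑' n, X.taboo s0 n g z := by
  obtain ⟨c, θ, hc, hθ0, hθ1, hT⟩ := hT
  have hind : ∀ n z, U z ≤ ∑' n, X.taboo s0 n g z + B * X.P z (alive s0 n) := by
    intro n
    induction n with
    | zero =>
      intro z
      have := X.isProb z
      rw [alive_zero, measure_univ, mul_one]
      exact (hB z).trans le_add_self
    | succ n ih =>
      intro z
      refine (hU z).trans ?_
      rw [tsum_taboo, add_assoc, measure_alive_succ,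
        ← lintegral_const_mul' _ _ hBt, ← lintegral_add_left
          (measurable_eval 1 fun w => if w.2 = s0 then 0 else ∑' n, X.taboo s0 n g w)]
      refine add_le_add le_rfl (lintegral_mono fun ω => ?_)
      dsimp only
      split_ifs
      · exact zero_le
      · exact ih (ω 1)
  have hlim : Tendsto (fun n : ℕ => ∑' n, X.taboo s0 n g z + B * ENNReal.ofReal (c * θ ^ n))
      atTop (𝓝 (∑' n, X.taboo s0 n g z + B * 0)) := by
    have h := (tendsto_pow_atTop_nhds_zero_of_lt_one hθ0.le hθ1).const_mul c
    rw [mul_zero] at h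
    have h' := ENNReal.tendsto_ofReal h
    rw [ENNReal.ofReal_zero] at h'
    exact (ENNReal.Tendsto.const_mul h' (Or.inr hBt)).const_add _
  rw [mul_zero, add_zero] at hlim
  exact ge_of_tendsto' hlim fun n => (hind n z).trans
    (add_le_add le_rfl (mul_le_mul_right (hT n z) B))

lemma tsum_taboo_le (X : MChain (ℕ × S)) (s0 : S) {q : ℝ} (hq : 2 ≤ q) {K : ℝ≥0∞}
    (hK : ∀ (l : ℕ) (_ : l ≤ 1) (z : ℕ × S),
      ∑' n, ∫⁻ ω, (alive s0 n).indicator (fun ω => (1 + edist (ω (n + l)).1 z.1) ^ q) ω ∂X.P z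
        ≤ K) {ρ : ℕ → ℝ} (hρ : SlowlyVarying ρ) (z : ℕ × S) :
    ∑' n, X.taboo s0 n (fun w => ENNReal.ofReal (ρ w.1)) z ≤ ENNReal.ofReal (ρ z.1) * K := by
  refine le_trans ?_ (mul_le_mul_right (hK 0 zero_le_one z) _)
  rw [← ENNReal.tsum_mul_left]
  refine ENNReal.tsum_le_tsum fun n => ?_
  rw [← lintegral_const_mul' _ _ ENNReal.ofReal_ne_top, taboo]
  refine lintegral_mono fun ω => ?_
  dsimp only
  by_cases hω : ω ∈ alive s0 n
  · simp only [Set.indicator_of_mem hω, add_zero]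
    refine (ENNReal.ofReal_le_ofReal (hρ.2 z.1 (ω n).1)).trans ?_
    rw [ENNReal.ofReal_mul (hρ.1 _)]
    refine mul_le_mul_right ?_ _
    have h2 := ofReal_one_add_abs_rpow (ω n).1 z.1 (zero_le_two : (0 : ℝ) ≤ 2)
    rw [Real.rpow_two] at h2
    rw [h2]
    exact ENNReal.rpow_le_rpow_of_exponent_le le_self_add hq
  · simp [Set.indicator_of_notMem hω]

/-- Bounded solutions of the first step equation inherit slowly varying bounds on the
inhomogeneity. -/
lemma exists_potential_bound (X : MChain (ℕ × S)) (s0 : S) {p : ℝ} (hp : 2 < p) (hB : CondB X p)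
    (hT : ∃ c θ : ℝ, 0 < c ∧ 0 < θ ∧ θ < 1 ∧
      ∀ n z, X.P z (alive s0 n) ≤ ENNReal.ofReal (c * θ ^ n)) :
    ∃ K : ℝ, 0 ≤ K ∧ ∀ (u : ℕ × S → ℝ) (ρ : ℕ → ℝ), (∃ B, ∀ z, |u z| ≤ B) → SlowlyVarying ρ →
      (∀ z, |u z - X.tabooStep s0 u z| ≤ ρ z.1) → ∀ z, |u z| ≤ K * ρ z.1 := by
  obtain ⟨K, hKt, hK⟩ := exists_excursion_moment_bound X s0 (by linarith : 1 ≤ p) zero_lt_two hp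
    hB hT
  refine ⟨K.toReal, ENNReal.toReal_nonneg, fun u ρ ⟨B, hu⟩ hρ hr z => ?_⟩
  have h1 := le_tsum_taboo X s0 hT (U := fun z => ENNReal.ofReal |u z|)
    (g := fun w => ENNReal.ofReal (ρ w.1)) (B := ENNReal.ofReal B) ENNReal.ofReal_ne_top
    (fun z => ENNReal.ofReal_le_ofReal (hu z)) (fun z => by
      have h2 : |u z| ≤ ρ z.1 + |X.tabooStep s0 u z| := by
        have := abs_sub_abs_le_abs_sub (u z) (X.tabooStep s0 u z)
        linarith [hr z]
      refine (ENNReal.ofReal_le_ofReal h2).trans ?_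
      rw [ENNReal.ofReal_add (hρ.1 _) (abs_nonneg _)]
      refine add_le_add le_rfl ?_
      have h3 := enorm_integral_le_lintegral_enorm (μ := X.P z)
        fun ω => if (ω 1).2 = s0 then 0 else u (ω 1)
      rw [← Real.enorm_eq_ofReal_abs]
      refine h3.trans (lintegral_mono fun ω => ?_)
      dsimp only
      split_ifs
      · simp
      · rw [Real.enorm_eq_ofReal_abs]) z
  have h4 := h1.trans (tsum_taboo_le X s0 le_rfl hK hρ z)
  rw [← ENNReal.ofReal_toReal hKt, ← ENNReal.ofReal_mul (hρ.1 _), mul_comm] at h4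
  exact (ENNReal.ofReal_le_ofReal_iff (mul_nonneg ENNReal.toReal_nonneg (hρ.1 _))).1 h4

section Asymptotic

variable (X : MChain (ℕ × S)) (s0 : S) {p : ℝ} (hp : 2 < p) (hB : CondB X p)
  (hT : ∃ c θ : ℝ, 0 < c ∧ 0 < θ ∧ θ < 1 ∧
    ∀ n z, X.P z (alive s0 n) ≤ ENNReal.ofReal (c * θ ^ n))
  {u : ℕ × S → ℝ} (hu : ∃ B, ∀ z, |u z| ≤ B)

include hp hB hT hu

lemma isBigO_of_first_step {α : ℝ} (h0 : 0 ≤ α) (h2 : α ≤ 2)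
    (hr : ∀ i, (fun x : ℕ => u (x, i) - X.tabooStep s0 u (x, i)) =O[atTop]
      fun x => weight x ^ (-α)) :
    ∃ C : ℝ, ∀ z, |u z| ≤ C * weight z.1 ^ (-α) := by
  obtain ⟨K, hK0, hK⟩ := exists_potential_bound X s0 hp hB hT
  have h1 : ∀ i, ∃ C > 0, ∀ x : ℕ, |u (x, i) - X.tabooStep s0 u (x, i)| ≤ C * weight x ^ (-α) := by
    intro i
    obtain ⟨C, hC, h⟩ := bound_of_isBigO_nat_atTop (hr i)
    refine ⟨C, hC, fun x => ?_⟩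
    have hw := Real.rpow_pos_of_pos (weight_pos x) (-α)
    simpa [abs_of_pos hw] using h hw.ne'
  choose C hC h using h1
  refine ⟨K * ∑ i, C i, fun z => ?_⟩
  rw [mul_assoc]
  refine hK u (fun x => (∑ i, C i) * weight x ^ (-α)) hu
    ((slowlyVarying_weight_rpow h0 h2).const_mul
    (Finset.sum_nonneg fun i _ => (hC i).le)) (fun w => (h w.2 w.1).trans ?_) z
  exact mul_le_mul_of_nonneg_right
    (Finset.single_le_sum (fun i _ => (hC i).le) (Finset.mem_univ w.2))
    (Real.rpow_nonneg (weight_pos _).le _)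

lemma isLittleO_of_first_step {α : ℝ} (h0 : 0 ≤ α) (h1 : α ≤ 1)
    (hr : ∀ i, (fun x : ℕ => u (x, i) - X.tabooStep s0 u (x, i)) =o[atTop]
      fun x => weight x ^ (-α)) (i : S) :
    (fun x : ℕ => u (x, i)) =o[atTop] fun x => weight x ^ (-α) := by
  obtain ⟨K, hK0, hK⟩ := exists_potential_bound X s0 hp hB hT
  refine isLittleO_iff.2 fun ε hε => ?_
  set η : ℝ := ε / (2 * (K + 1)) with hη
  have hη0 : 0 < η := by positivity
  have hev : ∀ᶠ x : ℕ in atTop, ∀ i, |u (x, i) - X.tabooStep s0 u (x, i)|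
      ≤ η * weight x ^ (-α) := eventually_all.2 fun i => by
    filter_upwards [isLittleO_iff.1 (hr i) hη0] with x hx
    simpa [abs_of_pos (Real.rpow_pos_of_pos (weight_pos x) (-α))] using hx
  obtain ⟨N, hN⟩ := eventually_atTop.1 hev
  obtain ⟨M, hM0, hM⟩ : ∃ M : ℝ, 0 ≤ M ∧ ∀ x < N, ∀ i,
      |u (x, i) - X.tabooStep s0 u (x, i)| ≤ M * weight x ^ (-2 : ℝ) := by
    refine ⟨∑ x ∈ Finset.range N, ∑ i, |u (x, i) - X.tabooStep s0 u (x, i)| * weight x ^ (2 : ℝ),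
      ?_, fun x hx i => ?_⟩
    · exact Finset.sum_nonneg fun x _ => Finset.sum_nonneg fun i _ =>
        mul_nonneg (abs_nonneg _) (Real.rpow_nonneg (weight_pos x).le _)
    · rw [Real.rpow_neg (weight_pos x).le, ← div_eq_mul_inv,
        le_div_iff₀ (Real.rpow_pos_of_pos (weight_pos x) _)]
      have hnn : ∀ x i, 0 ≤ |u (x, i) - X.tabooStep s0 u (x, i)| * weight x ^ (2 : ℝ) := fun x i =>
        mul_nonneg (abs_nonneg _) (Real.rpow_nonneg (weight_pos x).le _)
      exact (Finset.single_le_sum (f := fun i => |u (x, i) - X.tabooStep s0 u (x, i)|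
          * weight x ^ (2 : ℝ)) (fun i _ => hnn x i) (Finset.mem_univ i)).trans
        (Finset.single_le_sum (f := fun x => ∑ i, |u (x, i) - X.tabooStep s0 u (x, i)|
          * weight x ^ (2 : ℝ)) (fun x _ => Finset.sum_nonneg fun i _ => hnn x i)
          (Finset.mem_range.2 hx))
  have hbound := hK u (fun x => η * weight x ^ (-α) + M * weight x ^ (-2 : ℝ)) hu
    (((slowlyVarying_weight_rpow h0 (h1.trans one_le_two)).const_mul hη0.le).add
      ((slowlyVarying_weight_rpow zero_le_two le_rfl).const_mul hM0)) (fun z => by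
      have ha := Real.rpow_pos_of_pos (weight_pos z.1) (-α)
      have hb := Real.rpow_pos_of_pos (weight_pos z.1) (-2)
      rcases lt_or_ge z.1 N with hz | hz
      · exact (hM z.1 hz z.2).trans (le_add_of_nonneg_left (by positivity))
      · exact (hN z.1 hz z.2).trans (le_add_of_nonneg_right (by positivity)))
  have hsmall : ∀ᶠ x : ℕ in atTop, M * weight x ^ (-(1 : ℝ)) ≤ η := by
    have : Tendsto (fun x : ℕ => M * weight x ^ (-(1 : ℝ))) atTop (𝓝 0) := by
      simpa using ((tendsto_rpow_neg_atTop one_pos).comp tendsto_weight).const_mul M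
    filter_upwards [this.eventually_lt_const hη0] with x hx using hx.le
  filter_upwards [hsmall] with x hx
  have hw := weight_pos x
  have ha := Real.rpow_pos_of_pos hw (-α)
  rw [Real.norm_eq_abs, Real.norm_eq_abs, abs_of_pos ha]
  have h3 : M * weight x ^ (-2 : ℝ) ≤ η * weight x ^ (-α) := by
    have h4 : weight x ^ (-2 : ℝ) = weight x ^ (-(1 : ℝ)) * weight x ^ (-(1 : ℝ)) := by
      rw [← Real.rpow_add hw]
      norm_num
    rw [h4, ← mul_assoc]
    exact mul_le_mul hx (Real.rpow_le_rpow_of_exponent_le (one_le_weight x) (by linarith))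
      (Real.rpow_nonneg hw.le _) hη0.le
  have h5 := hbound (x, i)
  dsimp only at h5
  have h6 : ε = η * (2 * (K + 1)) := by
    rw [hη]
    field_simp
  rw [h6]
  nlinarith [mul_pos hη0 ha]

end Asymptotic

end MChain

lemma isBigO_weight_rpow {α β : ℝ} (h : α ≤ β) :
    (fun x => weight x ^ (-β)) =O[atTop] fun x => weight x ^ (-α) := by
  refine IsBigO.of_bound 1 (Eventually.of_forall fun x => ?_)
  have hw := weight_pos x
  rw [Real.norm_of_nonneg (Real.rpow_nonneg hw.le _),
    Real.norm_of_nonneg (Real.rpow_nonneg hw.le _), one_mul]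
  exact Real.rpow_le_rpow_of_exponent_le (one_le_weight x) (by linarith)

lemma weight_rpow_eventuallyEq (α : ℝ) :
    (fun x => weight x ^ α) =ᶠ[atTop] fun x : ℕ => (x : ℝ) ^ α := by
  filter_upwards [weight_eventuallyEq] with x hx
  rw [hx]

lemma abs_inv_weight_sub_le (x y : ℕ) :
    |(weight y)⁻¹ - (weight x)⁻¹| ≤ (1 + |(y : ℝ) - x|) ^ 2 * weight x ^ (-2 : ℝ) := by
  have hx := weight_pos x
  have hy := weight_pos y
  have h1 : |weight x - weight y| ≤ 1 + |(y : ℝ) - x| := by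
    rw [abs_sub_comm]
    linarith [abs_weight_sub_le x y]
  have h2 := weight_le_mul x y
  rw [inv_sub_inv hy.ne' hx.ne', abs_div, abs_of_pos (mul_pos hy hx), Real.rpow_neg hx.le,
    Real.rpow_two, ← div_eq_mul_inv, div_le_div_iff₀ (by positivity) (by positivity)]
  have h3 : 0 ≤ 1 + |(y : ℝ) - x| := by positivity
  calc |weight x - weight y| * weight x ^ 2
      ≤ (1 + |(y : ℝ) - x|) * weight x ^ 2 := mul_le_mul_of_nonneg_right h1 (by positivity)
    _ = (1 + |(y : ℝ) - x|) * weight x * weight x := by ring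
    _ ≤ (1 + |(y : ℝ) - x|) * weight x * (weight y * (1 + |(y : ℝ) - x|)) :=
        mul_le_mul_of_nonneg_left h2 (by positivity)
    _ = _ := by ring

lemma abs_killAt_le (s0 : S) (a : S → ℝ) (j : S) : |killAt s0 a j| ≤ ∑ i, |a i| := by
  by_cases h : j = s0
  · simpa [killAt, h] using Finset.sum_nonneg fun i _ => abs_nonneg (a i)
  · simpa [killAt, h] using
      Finset.single_le_sum (f := fun i => |a i|) (fun i _ => abs_nonneg _) (Finset.mem_univ j)

lemma abs_mul_inv_weight_le (a : S → ℝ) (z : ℕ × S) :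
    |a z.2 * (weight z.1)⁻¹| ≤ ∑ i, |a i| := by
  rw [abs_mul, abs_of_pos (inv_pos.2 (weight_pos z.1))]
  exact (mul_le_of_le_one_right (abs_nonneg _) (inv_le_one_of_one_le₀ (one_le_weight _))).trans
    (Finset.single_le_sum (f := fun i => |a i|) (fun i _ => abs_nonneg _) (Finset.mem_univ z.2))

namespace MChain

section FirstStep

variable (X : MChain (ℕ × S)) (s0 : S)

lemma integrable_killed {u : ℕ × S → ℝ} {B : ℝ} (hu : ∀ z, |u z| ≤ B) (z : ℕ × S) :
    Integrable (fun ω : ℕ → ℕ × S => if (ω 1).2 = s0 then 0 else u (ω 1)) (X.P z) :=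
  integrable_of_abs_le X z (measurable_eval 1 fun w => if w.2 = s0 then 0 else u w) fun ω => by
    split_ifs
    · exact abs_zero.trans_le ((abs_nonneg _).trans (hu z))
    · exact hu _

lemma tabooStep_sub {u v : ℕ × S → ℝ} {B B' : ℝ} (hu : ∀ z, |u z| ≤ B) (hv : ∀ z, |v z| ≤ B')
    (z : ℕ × S) :
    X.tabooStep s0 (fun w => u w - v w) z = X.tabooStep s0 u z - X.tabooStep s0 v z := by
  rw [tabooStep, tabooStep, tabooStep,
    ← integral_sub (X.integrable_killed s0 hu z) (X.integrable_killed s0 hv z)]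
  refine integral_congr_ae (Eventually.of_forall fun ω => ?_)
  dsimp only
  split_ifs <;> simp

lemma tabooStep_snd (a : S → ℝ) (x : ℕ) (i : S) :
    X.tabooStep s0 (fun w => a w.2) (x, i) = ∑ j, qhat X x i j * killAt s0 a j :=
  X.integral_snd x i (killAt s0 a)

lemma tabooStep_div_weight {C : ℝ} (hC : ∀ z : ℕ × S,
      Integrable (fun ω => (1 + |((ω 1).1 : ℝ) - z.1|) ^ 2) (X.P z) ∧
      ∫ ω, (1 + |((ω 1).1 : ℝ) - z.1|) ^ 2 ∂X.P z ≤ C) (a : S → ℝ) (x : ℕ) (i : S) :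
    |X.tabooStep s0 (fun w => a w.2 * (weight w.1)⁻¹) (x, i)
        - (∑ j, qhat X x i j * killAt s0 a j) * (weight x)⁻¹|
      ≤ ((∑ i, |a i|) * C) * weight x ^ (-2 : ℝ) := by
  set A := ∑ i, |a i| with hA
  have hA0 : 0 ≤ A := Finset.sum_nonneg fun i _ => abs_nonneg (a i)
  have hinv : ∀ y, |(weight y)⁻¹| ≤ 1 := fun y => by
    rw [abs_of_pos (inv_pos.2 (weight_pos y))]
    exact inv_le_one_of_one_le₀ (one_le_weight y)
  have hI1 : Integrable (fun ω : ℕ → ℕ × S => killAt s0 a (ω 1).2 * (weight (ω 1).1)⁻¹)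
      (X.P (x, i)) :=
    integrable_of_abs_le X _ (B := A * 1)
      (measurable_eval 1 fun w => killAt s0 a w.2 * (weight w.1)⁻¹) fun ω => by
        rw [abs_mul]
        exact mul_le_mul (abs_killAt_le s0 a _) (hinv _) (abs_nonneg _) hA0
  have hI2 : Integrable (fun ω : ℕ → ℕ × S => killAt s0 a (ω 1).2 * (weight x)⁻¹)
      (X.P (x, i)) :=
    (integrable_of_abs_le X _ (measurable_eval 1 fun w => killAt s0 a w.2)
      fun ω => abs_killAt_le s0 a _).mul_const _
  have h1 : X.tabooStep s0 (fun w => a w.2 * (weight w.1)⁻¹) (x, i)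
      = ∫ ω, killAt s0 a (ω 1).2 * (weight (ω 1).1)⁻¹ ∂X.P (x, i) := by
    refine integral_congr_ae (Eventually.of_forall fun ω => ?_)
    simp only [killAt]
    split_ifs <;> simp
  rw [h1, ← X.integral_snd x i (killAt s0 a), ← integral_mul_const, ← integral_sub hI1 hI2]
  have h2 := norm_integral_le_of_norm_le (μ := X.P (x, i))
    (f := fun ω => killAt s0 a (ω 1).2 * (weight (ω 1).1)⁻¹ - killAt s0 a (ω 1).2 * (weight x)⁻¹)
    (((hC (x, i)).1.const_mul A).mul_const (weight x ^ (-2 : ℝ)))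
    (Eventually.of_forall fun ω => by
      rw [Real.norm_eq_abs, ← mul_sub, abs_mul, mul_assoc]
      exact mul_le_mul (abs_killAt_le s0 a _) (abs_inv_weight_sub_le x _) (abs_nonneg _) hA0)
  refine h2.trans ?_
  rw [integral_mul_const, integral_const_mul]
  exact mul_le_mul_of_nonneg_right (mul_le_mul_of_nonneg_left (hC (x, i)).2 hA0)
    (Real.rpow_nonneg (weight_pos x).le _)

lemma abs_cross_le {C D : ℝ} (hC : ∀ z : ℕ × S,
      Integrable (fun ω => (1 + |((ω 1).1 : ℝ) - z.1|) ^ 2) (X.P z) ∧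
      ∫ ω, (1 + |((ω 1).1 : ℝ) - z.1|) ^ 2 ∂X.P z ≤ C) {m : ℕ × S → ℝ}
    (hm : ∀ z, |m z| ≤ D * weight z.1 ^ (-(1 : ℝ))) (x : ℕ) (i : S) :
    |∫ ω, (((ω 1).1 : ℝ) - x) * (if (ω 1).2 = s0 then 0 else m (ω 1)) ∂X.P (x, i)|
      ≤ D * C * weight x ^ (-(1 : ℝ)) := by
  have hD : 0 ≤ D := by
    have h := (abs_nonneg _).trans (hm (x, i))
    exact nonneg_of_mul_nonneg_left h (Real.rpow_pos_of_pos (weight_pos x) _)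
  have h2 := norm_integral_le_of_norm_le (μ := X.P (x, i))
    (f := fun ω => (((ω 1).1 : ℝ) - x) * (if (ω 1).2 = s0 then 0 else m (ω 1)))
    (((hC (x, i)).1.const_mul D).mul_const (weight x ^ (-(1 : ℝ))))
    (Eventually.of_forall fun ω => by
      have hx := weight_pos x
      have hy := weight_pos (ω 1).1
      have h3 : |if (ω 1).2 = s0 then 0 else m (ω 1)| ≤ D * (weight (ω 1).1)⁻¹ := by
        split_ifs
        · rw [abs_zero]
          positivity
        · have := hm (ω 1)
          rwa [Real.rpow_neg_one] at this
      have h4 : (weight (ω 1).1)⁻¹ ≤ (1 + |((ω 1).1 : ℝ) - x|) * (weight x)⁻¹ := by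
        rw [← div_eq_mul_inv, inv_le_iff_one_le_mul₀ hy, div_mul_eq_mul_div, le_div_iff₀ hx,
          one_mul, mul_comm]
        exact weight_le_mul x (ω 1).1
      have h5 := abs_nonneg (((ω 1).1 : ℝ) - x)
      rw [Real.norm_eq_abs, abs_mul, Real.rpow_neg_one]
      calc _ ≤ (1 + |((ω 1).1 : ℝ) - x|) * (D * ((1 + |((ω 1).1 : ℝ) - x|) * (weight x)⁻¹)) :=
            mul_le_mul (by linarith) (h3.trans (mul_le_mul_of_nonneg_left h4 hD))
              (abs_nonneg _) (by linarith)
        _ = _ := by ring)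
  refine h2.trans ?_
  rw [integral_mul_const, integral_const_mul]
  exact mul_le_mul_of_nonneg_right (mul_le_mul_of_nonneg_left (hC (x, i)).2 hD)
    (Real.rpow_nonneg (weight_pos x).le _)

lemma isLittleO_sum_qhat {Q : S → S → ℝ} (hQ : ∀ i j, Tendsto (fun x : ℕ => qhat X x i j) atTop
    (𝓝 (Q i j))) (b : S → ℝ) (i : S) :
    (fun x : ℕ => ∑ j, (qhat X x i j - Q i j) * b j) =o[atTop] fun _ => (1 : ℝ) := by
  rw [isLittleO_one_iff]
  have h : Tendsto (fun x : ℕ => ∑ j, (qhat X x i j - Q i j) * b j) atTop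
      (𝓝 (∑ j, (Q i j - Q i j) * b j)) :=
    tendsto_finsetSum _ fun j _ => ((hQ i j).sub_const _).mul_const _
  simpa using h

lemma isBigO_sum_qhat {Q : S → S → ℝ} {δ : ℝ} (hQ : ∀ i j,
      (fun x : ℕ => qhat X x i j - Q i j) =O[atTop] fun x => weight x ^ (-δ)) (b : S → ℝ) (i : S) :
    (fun x : ℕ => ∑ j, (qhat X x i j - Q i j) * b j) =O[atTop] fun x => weight x ^ (-δ) :=
  IsBigO.fun_sum fun j _ => by
    simpa only [mul_comm] using (hQ i j).const_mul_left (b j)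

variable {p : ℝ} (hp : 2 < p) (hB : CondB X p)
  (hT : ∃ c θ : ℝ, 0 < c ∧ 0 < θ ∧ θ < 1 ∧
    ∀ n z, X.P z (alive s0 n) ≤ ENNReal.ofReal (c * θ ^ n))
  {C : ℝ} (hC : ∀ z : ℕ × S,
      Integrable (fun ω => (1 + |((ω 1).1 : ℝ) - z.1|) ^ 2) (X.P z) ∧
      ∫ ω, (1 + |((ω 1).1 : ℝ) - z.1|) ^ 2 ∂X.P z ≤ C)
  {m v : ℕ × S → ℝ} {B : ℝ} (hm : ∀ z, |m z| ≤ B) (hv : ∀ z, |v z| ≤ B)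
  (hmeq : ∀ x i, m (x, i) = stepMoment X 1 x i + X.tabooStep s0 m (x, i))
  (hveq : ∀ x i, v (x, i) = stepMoment X 2 x i
    + 2 * ∫ ω, (((ω 1).1 : ℝ) - x) * (if (ω 1).2 = s0 then 0 else m (ω 1)) ∂X.P (x, i)
    + X.tabooStep s0 v (x, i))
  {Q : S → S → ℝ} {c s2 a : S → ℝ}

include hmeq hC hm in
/-- Defect of the approximation `a i / x` to the mean displacement in the first step equation. -/
lemma isBigO_mean_defect (ha : ∀ i, a i = c i + ∑ j, Q i j * killAt s0 a j) (i : S) :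
    (fun x : ℕ => ((m (x, i) - a i * (weight x)⁻¹)
        - X.tabooStep s0 (fun w => m w - a w.2 * (weight w.1)⁻¹) (x, i))
      - ((stepMoment X 1 x i - c i * (weight x)⁻¹)
        + (∑ j, (qhat X x i j - Q i j) * killAt s0 a j) * (weight x)⁻¹))
      =O[atTop] fun x => weight x ^ (-2 : ℝ) := by
  refine IsBigO.of_bound ((∑ i, |a i|) * C) (Eventually.of_forall fun x => ?_)
  rw [X.tabooStep_sub s0 hm (abs_mul_inv_weight_le a),
    Real.norm_of_nonneg (Real.rpow_nonneg (weight_pos x).le _)]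
  refine le_trans (le_of_eq ?_) (X.tabooStep_div_weight s0 hC a x i)
  rw [Real.norm_eq_abs]
  congr 1
  simp only [sub_mul, Finset.sum_sub_distrib]
  rw [hmeq x i, ha i]
  ring

include hveq in
lemma secondMoment_defect (hv : ∀ z, |v z| ≤ B)
    (ha : ∀ i, a i = s2 i + ∑ j, Q i j * killAt s0 a j) (x : ℕ) (i : S) :
    (v (x, i) - a i) - X.tabooStep s0 (fun w => v w - a w.2) (x, i)
      = (stepMoment X 2 x i - s2 i) + (∑ j, (qhat X x i j - Q i j) * killAt s0 a j)
        + 2 * ∫ ω, (((ω 1).1 : ℝ) - x) * (if (ω 1).2 = s0 then 0 else m (ω 1)) ∂X.P (x, i) := by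
  have hb : ∀ z : ℕ × S, |a z.2| ≤ ∑ i, |a i| := fun z =>
    Finset.single_le_sum (f := fun i => |a i|) (fun i _ => abs_nonneg _) (Finset.mem_univ z.2)
  have hsum : ∑ j, (qhat X x i j - Q i j) * killAt s0 a j
      = ∑ j, qhat X x i j * killAt s0 a j - ∑ j, Q i j * killAt s0 a j := by
    simp only [sub_mul, Finset.sum_sub_distrib]
  rw [X.tabooStep_sub s0 hv hb, X.tabooStep_snd, hsum, hveq x i, ha i]
  ring

include hp hB hT hm hmeq

lemma exists_mean_bound
    (hc : ∀ i, (fun x : ℕ => stepMoment X 1 x i) =O[atTop] fun x => weight x ^ (-(1 : ℝ))) :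
    ∃ D : ℝ, ∀ z, |m z| ≤ D * weight z.1 ^ (-(1 : ℝ)) :=
  isBigO_of_first_step X s0 hp hB hT ⟨B, hm⟩ zero_le_one one_le_two fun i => by
    refine (hc i).congr_left fun x => ?_
    rw [hmeq x i]
    ring

include hC

lemma isLittleO_mean (hQ : ∀ i j, Tendsto (fun x : ℕ => qhat X x i j) atTop (𝓝 (Q i j)))
    (hc : ∀ i, (fun x : ℕ => stepMoment X 1 x i - c i * (weight x)⁻¹) =o[atTop]
      fun x => weight x ^ (-(1 : ℝ)))
    (ha : ∀ i, a i = c i + ∑ j, Q i j * killAt s0 a j) (i : S) :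
    (fun x : ℕ => m (x, i) - a i * (weight x)⁻¹) =o[atTop] fun x => weight x ^ (-(1 : ℝ)) := by
  refine isLittleO_of_first_step X s0 hp hB hT (u := fun w => m w - a w.2 * (weight w.1)⁻¹)
    ⟨B + ∑ i, |a i|, fun z => (abs_sub _ _).trans (add_le_add (hm z) (abs_mul_inv_weight_le a z))⟩
    zero_le_one le_rfl (fun i => ?_) i
  have h1 : (fun x => weight x ^ (-2 : ℝ)) =o[atTop] fun x => weight x ^ (-(1 : ℝ)) :=
    (((isLittleO_one_iff ℝ).2 ((tendsto_rpow_neg_atTop one_pos).comp tendsto_weight)).mul_isBigO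
      (isBigO_refl (fun x => weight x ^ (-(1 : ℝ))) atTop)).congr
      (fun x => by
        rw [Function.comp_apply, ← Real.rpow_add (weight_pos x)]
        norm_num) fun x => one_mul _
  have h2 : (fun x : ℕ => (∑ j, (qhat X x i j - Q i j) * killAt s0 a j) * (weight x)⁻¹)
      =o[atTop] fun x => weight x ^ (-(1 : ℝ)) := by
    simpa only [one_mul, Real.rpow_neg_one] using
      (X.isLittleO_sum_qhat hQ (killAt s0 a) i).mul_isBigO
        (isBigO_refl (fun x => (weight x)⁻¹) atTop)
  simpa using ((X.isBigO_mean_defect s0 hC hm hmeq ha i).trans_isLittleO h1).add ((hc i).add h2)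

lemma isBigO_mean {δ : ℝ} (hδ0 : 0 ≤ δ) (hδ1 : δ ≤ 1)
    (hQ : ∀ i j, (fun x : ℕ => qhat X x i j - Q i j) =O[atTop] fun x => weight x ^ (-δ))
    (hc : ∀ i, (fun x : ℕ => stepMoment X 1 x i - c i * (weight x)⁻¹) =O[atTop]
      fun x => weight x ^ (-(1 + δ)))
    (ha : ∀ i, a i = c i + ∑ j, Q i j * killAt s0 a j) (i : S) :
    (fun x : ℕ => m (x, i) - a i * (weight x)⁻¹) =O[atTop] fun x => weight x ^ (-(1 + δ)) := by
  obtain ⟨D, hD⟩ := isBigO_of_first_step X s0 hp hB hT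
    (u := fun w => m w - a w.2 * (weight w.1)⁻¹)
    ⟨B + ∑ i, |a i|, fun z => (abs_sub _ _).trans (add_le_add (hm z) (abs_mul_inv_weight_le a z))⟩
    (α := 1 + δ) (by linarith) (by linarith) fun i => by
      have h1 : (fun x => weight x ^ (-2 : ℝ)) =O[atTop] fun x => weight x ^ (-(1 + δ)) :=
        isBigO_weight_rpow (by linarith)
      have h2 : (fun x : ℕ => (∑ j, (qhat X x i j - Q i j) * killAt s0 a j) * (weight x)⁻¹)
          =O[atTop] fun x => weight x ^ (-(1 + δ)) := by
        refine ((X.isBigO_sum_qhat hQ (killAt s0 a) i).mul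
          (isBigO_refl (fun x => (weight x)⁻¹) atTop)).congr_right fun x => ?_
        rw [neg_add_rev, Real.rpow_add (weight_pos x), Real.rpow_neg_one]
      simpa using ((X.isBigO_mean_defect s0 hC hm hmeq ha i).trans h1).add ((hc i).add h2)
  refine IsBigO.of_bound D (Eventually.of_forall fun x => ?_)
  rw [Real.norm_of_nonneg (Real.rpow_nonneg (weight_pos x).le _)]
  exact hD (x, i)

lemma isBigO_cross
    (hc : ∀ i, (fun x : ℕ => stepMoment X 1 x i) =O[atTop] fun x => weight x ^ (-(1 : ℝ)))
    (i : S) :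
    (fun x : ℕ => 2 * ∫ ω, (((ω 1).1 : ℝ) - x) * (if (ω 1).2 = s0 then 0 else m (ω 1))
      ∂X.P (x, i)) =O[atTop] fun x => weight x ^ (-(1 : ℝ)) := by
  obtain ⟨D, hD⟩ := X.exists_mean_bound s0 hp hB hT hm hmeq hc
  refine (IsBigO.of_bound (D * C) (Eventually.of_forall fun x => ?_)).const_mul_left 2
  rw [Real.norm_of_nonneg (Real.rpow_nonneg (weight_pos x).le _)]
  exact X.abs_cross_le s0 hC hD x i

include hv hveq

lemma tendsto_sq (hQ : ∀ i j, Tendsto (fun x : ℕ => qhat X x i j) atTop (𝓝 (Q i j)))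
    (hc : ∀ i, (fun x : ℕ => stepMoment X 1 x i) =O[atTop] fun x => weight x ^ (-(1 : ℝ)))
    (hs : ∀ i, Tendsto (fun x : ℕ => stepMoment X 2 x i) atTop (𝓝 (s2 i)))
    (ha : ∀ i, a i = s2 i + ∑ j, Q i j * killAt s0 a j) (i : S) :
    Tendsto (fun x : ℕ => v (x, i)) atTop (𝓝 (a i)) := by
  have h := isLittleO_of_first_step X s0 hp hB hT (u := fun w => v w - a w.2)
    ⟨B + ∑ i, |a i|, fun z => (abs_sub _ _).trans (add_le_add (hv z)
      (Finset.single_le_sum (f := fun i => |a i|) (fun i _ => abs_nonneg _)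
        (Finset.mem_univ z.2)))⟩ (α := 0) le_rfl zero_le_one (fun i => by
      refine IsLittleO.congr_left ?_
        fun x => (X.secondMoment_defect s0 hveq hv ha x i).symm
      simp only [neg_zero, Real.rpow_zero]
      have h1 : (fun x => weight x ^ (-(1 : ℝ))) =o[atTop] fun _ => (1 : ℝ) :=
        (isLittleO_one_iff ℝ).2 ((tendsto_rpow_neg_atTop one_pos).comp tendsto_weight)
      have h2 : (fun x : ℕ => stepMoment X 2 x i - s2 i) =o[atTop] fun _ => (1 : ℝ) :=
        (isLittleO_one_iff ℝ).2 (tendsto_sub_nhds_zero_iff.2 (hs i))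
      exact (h2.add (X.isLittleO_sum_qhat hQ (killAt s0 a) i)).add
        ((X.isBigO_cross s0 hp hB hT hC hm hmeq hc i).trans_isLittleO h1)) i
  simp only [neg_zero, Real.rpow_zero] at h
  exact tendsto_sub_nhds_zero_iff.1 ((isLittleO_one_iff ℝ).1 h)

lemma isBigO_sq {δ : ℝ} (hδ0 : 0 ≤ δ) (hδ1 : δ ≤ 1)
    (hQ : ∀ i j, (fun x : ℕ => qhat X x i j - Q i j) =O[atTop] fun x => weight x ^ (-δ))
    (hc : ∀ i, (fun x : ℕ => stepMoment X 1 x i) =O[atTop] fun x => weight x ^ (-(1 : ℝ)))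
    (hs : ∀ i, (fun x : ℕ => stepMoment X 2 x i - s2 i) =O[atTop] fun x => weight x ^ (-δ))
    (ha : ∀ i, a i = s2 i + ∑ j, Q i j * killAt s0 a j) (i : S) :
    (fun x : ℕ => v (x, i) - a i) =O[atTop] fun x => weight x ^ (-δ) := by
  obtain ⟨D, hD⟩ := isBigO_of_first_step X s0 hp hB hT (u := fun w => v w - a w.2)
    ⟨B + ∑ i, |a i|, fun z => (abs_sub _ _).trans (add_le_add (hv z)
      (Finset.single_le_sum (f := fun i => |a i|) (fun i _ => abs_nonneg _)
        (Finset.mem_univ z.2)))⟩ hδ0 (hδ1.trans one_le_two) (fun i => by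
      refine IsBigO.congr_left ?_
        fun x => (X.secondMoment_defect s0 hveq hv ha x i).symm
      exact ((hs i).add (X.isBigO_sum_qhat hQ (killAt s0 a) i)).add
        ((X.isBigO_cross s0 hp hB hT hC hm hmeq hc i).trans (isBigO_weight_rpow hδ1)))
  refine IsBigO.of_bound D (Eventually.of_forall fun x => ?_)
  rw [Real.norm_of_nonneg (Real.rpow_nonneg (weight_pos x).le _)]
  exact hD (x, i)

end FirstStep

end MChain

/-- Lemma (embedded increments, Lamperti case): under (B_p) for some `p > 2`, (Q_∞) and (M_L),
the embedded increments `Y_1 − Y_0 = X_τ − X_0` (under `P_{x,s0}`) have uniformly bounded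
`(2+ε)`-moments, first moment `(Σ_i c_i π(i))/(π(s0) x) + o(1/x)` and second moment
`(Σ_i s_i² π(i))/π(s0) + o(1)`; under (Q_∞^+) and (M_L^+) the error terms are power-law. -/
theorem stmt14 (X : MChain (ℕ × S)) (hirr : X.Irreducible) (s0 : S)
    (p : ℝ) (hp : 2 < p) (hB : CondB X p)
    (Q : S → S → ℝ) (pst : S → ℝ) (hQ : CondQ X Q) (hpst : IsStationaryDist Q pst)
    (c s2 : S → ℝ) (hML : CondML X c s2) :
    (∃ ε : ℝ, 0 < ε ∧ ∃ C : ℝ≥0∞, C ≠ ⊤ ∧ ∀ x : ℕ,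
      (∫⁻ ω, ENNReal.ofReal (|((ω (tauRet s0 ω)).1 : ℝ) - (x : ℝ)| ^ (2 + ε))
        ∂(X.P (x, s0))) ≤ C) ∧
    Tendsto (fun x : ℕ =>
        (x : ℝ) * ∫ ω, (((ω (tauRet s0 ω)).1 : ℝ) - (x : ℝ)) ∂(X.P (x, s0)))
      atTop (nhds ((∑ i, c i * pst i) / pst s0)) ∧
    Tendsto (fun x : ℕ =>
        ∫ ω, (((ω (tauRet s0 ω)).1 : ℝ) - (x : ℝ)) ^ 2 ∂(X.P (x, s0)))
      atTop (nhds ((∑ i, s2 i * pst i) / pst s0)) ∧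
    (CondQplus X Q → CondMLplus X c s2 → ∃ δ : ℝ, 0 < δ ∧
      ((fun x : ℕ =>
          (∫ ω, (((ω (tauRet s0 ω)).1 : ℝ) - (x : ℝ)) ∂(X.P (x, s0)))
            - (∑ i, c i * pst i) / (pst s0 * x))
        =O[atTop] fun x : ℕ => (x : ℝ) ^ (-1 - δ)) ∧
      ((fun x : ℕ =>
          (∫ ω, (((ω (tauRet s0 ω)).1 : ℝ) - (x : ℝ)) ^ 2 ∂(X.P (x, s0)))
            - (∑ i, s2 i * pst i) / pst s0)
        =O[atTop] fun x : ℕ => (x : ℝ) ^ (-δ))) := by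
  obtain ⟨-, -, hM1, hM2⟩ := hML
  have hT := X.exists_geometric_tail s0 (X.exists_uniform_tail hirr s0 hp hB hQ hpst)
  have hp1 : 1 ≤ p := by linarith
  obtain ⟨K, hKt, hK⟩ := X.exists_excursion_moment_bound s0 (q := (p + 2) / 2) hp1 (by linarith)
    (by linarith) hB hT
  have hτ := X.ae_tauRet_ne_zero s0 hT
  have hret := X.lintegral_returnPos_le s0 hτ hK
  obtain ⟨B, hBd⟩ := X.exists_returnPos_sq_bound s0 (by linarith : 2 ≤ (p + 2) / 2) hKt hret
  obtain ⟨C, -, hC⟩ := X.exists_step_sq_bound hp hB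
  have hS : ∀ z : ℕ × S, MemLp (fun ω => ((ω 1).1 : ℝ) - z.1) 2 (X.P z) := fun z => by
    have hm : Measurable fun ω : ℕ → ℕ × S => ((ω 1).1 : ℝ) - z.1 :=
      MChain.measurable_eval 1 fun w : ℕ × S => (w.1 : ℝ) - z.1
    refine (memLp_two_iff_integrable_sq hm.aestronglyMeasurable).2 ((hC z).1.mono'
      (hm.pow_const 2).aestronglyMeasurable (Eventually.of_forall fun ω => ?_))
    rw [norm_pow, Real.norm_eq_abs]
    exact pow_le_pow_left₀ (abs_nonneg _) (by linarith) 2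
  have heq := X.excursion_equations s0 hτ (fun z => (hBd z).1) hS
  have hm := fun z => (hBd z).2.1
  have hv := fun z => (hBd z).2.2
  have hmeq := fun x i => (heq x i).1
  have hveq := fun x i => (heq x i).2
  obtain ⟨a, ha, ha0⟩ := exists_excursion_sum hpst hQ.2.1 hQ.2.2 s0 c
  obtain ⟨b, hb, hb0⟩ := exists_excursion_sum hpst hQ.2.1 hQ.2.2 s0 s2
  have hdrift : ∀ i, (fun x : ℕ => stepMoment X 1 x i - c i * (weight x)⁻¹) =o[atTop]
      fun x => weight x ^ (-(1 : ℝ)) := fun i => by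
    have h1 : (fun x : ℕ => (x : ℝ) * stepMoment X 1 x i - c i) =o[atTop] fun _ => (1 : ℝ) :=
      (isLittleO_one_iff ℝ).2 (tendsto_sub_nhds_zero_iff.2 (hM1 i))
    refine (h1.mul_isBigO (isBigO_refl (fun x => weight x ^ (-(1 : ℝ))) atTop)).congr' ?_
      (Eventually.of_forall fun x => one_mul _)
    filter_upwards [weight_eventuallyEq] with x hx
    have := (weight_pos x).ne'
    rw [← hx, Real.rpow_neg_one]
    field_simp
  have hdrift' : ∀ i, (fun x : ℕ => stepMoment X 1 x i) =O[atTop]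
      fun x => weight x ^ (-(1 : ℝ)) := fun i => by
    have h1 : (fun x : ℕ => c i * (weight x)⁻¹) =O[atTop] fun x => weight x ^ (-(1 : ℝ)) := by
      simp only [Real.rpow_neg_one]
      exact isBigO_const_mul_self _ _ _
    simpa using (hdrift i).isBigO.add h1
  refine ⟨⟨(p - 2) / 2, by linarith, K, hKt, fun x => ?_⟩, ?_, ?_, fun hQp hMp => ?_⟩
  · refine le_trans (lintegral_mono fun ω => ?_) (hret (x, s0))
    have hq : 2 + (p - 2) / 2 = (p + 2) / 2 := by ring
    rw [hq, ← MChain.ofReal_one_add_abs_rpow _ _ (by linarith)]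
    exact ENNReal.ofReal_le_ofReal (Real.rpow_le_rpow (abs_nonneg _)
      (le_add_of_nonneg_left zero_le_one) (by linarith))
  · rw [← ha0]
    have h := X.isLittleO_mean s0 hp hB hT hC hm hmeq hQ.1 hdrift ha s0
    have h1 := h.tendsto_div_nhds_zero
    refine tendsto_sub_nhds_zero_iff.1 (h1.congr' ?_)
    filter_upwards [weight_eventuallyEq] with x hx
    have := (weight_pos x).ne'
    change _ = (x : ℝ) * X.excMean s0 (x, s0) - a s0
    rw [Real.rpow_neg_one, div_inv_eq_mul, ← hx, sub_mul, mul_assoc, inv_mul_cancel₀ this, mul_one,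
      mul_comm]
  · rw [← hb0]
    exact X.tendsto_sq s0 hp hB hT hC hm hv hmeq hveq hQ.1 hdrift' hM2 hb s0
  · obtain ⟨⟨δ₀, hδ₀, hQδ⟩, -⟩ := hQp
    obtain ⟨-, -, δ₁, hδ₁, hMδ⟩ := hMp
    set δ := min (min δ₀ δ₁) 1 with hδ
    have hδpos : 0 < δ := lt_min (lt_min hδ₀ hδ₁) one_pos
    have hδ1 : δ ≤ 1 := min_le_right _ _
    have hle0 : δ ≤ δ₀ := (min_le_left _ _).trans (min_le_left _ _)
    have hle1 : δ ≤ δ₁ := (min_le_left _ _).trans (min_le_right _ _)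
    have hQw : ∀ i j, (fun x : ℕ => qhat X x i j - Q i j) =O[atTop] fun x => weight x ^ (-δ) :=
      fun i j => ((hQδ i j).trans_eventuallyEq (weight_rpow_eventuallyEq _).symm).trans
        (isBigO_weight_rpow hle0)
    have hcw : ∀ i, (fun x : ℕ => stepMoment X 1 x i - c i * (weight x)⁻¹) =O[atTop]
        fun x => weight x ^ (-(1 + δ)) := fun i => by
      refine IsBigO.trans ?_ (isBigO_weight_rpow (by linarith : 1 + δ ≤ 1 + δ₁))
      refine (hMδ i).1.congr' ?_ ?_
      · filter_upwards [weight_eventuallyEq] with x hx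
        rw [hx, div_eq_mul_inv]
      · rw [neg_add']
        exact (weight_rpow_eventuallyEq _).symm
    have hsw : ∀ i, (fun x : ℕ => stepMoment X 2 x i - s2 i) =O[atTop]
        fun x => weight x ^ (-δ) := fun i =>
      ((hMδ i).2.trans_eventuallyEq (weight_rpow_eventuallyEq _).symm).trans
        (isBigO_weight_rpow hle1)
    refine ⟨δ, hδpos, ?_, ?_⟩
    · refine (X.isBigO_mean s0 hp hB hT hC hm hmeq hδpos.le hδ1 hQw hcw ha s0).congr' ?_ ?_
      · filter_upwards [weight_eventuallyEq] with x hx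
        rw [hx, ha0, ← div_eq_mul_inv, div_div]
        rfl
      · rw [neg_add']
        exact weight_rpow_eventuallyEq _
    · rw [← hb0]
      exact (X.isBigO_sq s0 hp hB hT hC hm hv hmeq hveq hδpos.le hδ1 hQw hdrift' hsw hb
        s0).trans_eventuallyEq (weight_rpow_eventuallyEq _)
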